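/- arXiv:2301.11593 — 2 statements merged into one kernel-verified Lean document; each statement's English description precedes it below -/
import Mathlib

section
/- Let H = ℂ[ι^{±1}] with |ι| = -2 be the graded ring of Laurent polynomials. Then H is intrinsically formal: every A∞-algebra structure (m_3, m_4, ...) on H extending its multiplication is A∞-isomorphic to the trivial one; equivalently, any DG algebra A with H(A) ≅ ℂ[ι^{±1}] as graded algebras is formal. -/
/-- The sign `(-1)^k` acting on an additive group. -/
def esign {A : Type*} [AddCommGroup A] (k : ℤ) (a : A) : A := if Even k then a else -a

/-- Transport along an equality of degrees. -/
def dcast (C : ℤ → Type*) {i j : ℤ} (h : i = j) (x : C i) : C j :=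
  cast (congrArg C h) x

/-- A differential graded algebra over ℂ: a ℤ-graded ℂ-vector space with an associative
unital bilinear multiplication and a square-zero differential of degree `+1` satisfying
the graded Leibniz rule. -/
structure DGA where
  C : ℤ → Type
  [acg : ∀ i, AddCommGroup (C i)]
  [mod : ∀ i, Module ℂ (C i)]
  one : C 0
  mul : ∀ {i j : ℤ}, C i → C j → C (i + j)
  d : ∀ {i : ℤ}, C i → C (i + 1)
  d_add : ∀ {i : ℤ} (x y : C i), d (x + y) = d x + d y
  d_smul : ∀ {i : ℤ} (c : ℂ) (x : C i), d (c • x) = c • d x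
  d_d : ∀ {i : ℤ} (x : C i), d (d x) = 0
  mul_add : ∀ {i j : ℤ} (x : C i) (y z : C j), mul x (y + z) = mul x y + mul x z
  add_mul : ∀ {i j : ℤ} (x y : C i) (z : C j), mul (x + y) z = mul x z + mul y z
  smul_mul : ∀ {i j : ℤ} (c : ℂ) (x : C i) (y : C j), mul (c • x) y = c • mul x y
  mul_smul : ∀ {i j : ℤ} (c : ℂ) (x : C i) (y : C j), mul x (c • y) = c • mul x y
  one_mul : ∀ {i : ℤ} (x : C i), dcast C (zero_add i) (mul one x) = x
  mul_one : ∀ {i : ℤ} (x : C i), dcast C (add_zero i) (mul x one) = x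
  mul_assoc : ∀ {i j k : ℤ} (x : C i) (y : C j) (z : C k),
    dcast C (add_assoc i j k) (mul (mul x y) z) = mul x (mul y z)
  leibniz : ∀ {i j : ℤ} (x : C i) (y : C j),
    d (mul x y) =
      dcast C (by omega) (mul (d x) y) + esign i (dcast C (by omega) (mul x (d y)))

attribute [instance] DGA.acg DGA.mod

/-- A morphism of DG algebras. -/
structure DGAHom (A B : DGA) where
  f : ∀ i : ℤ, A.C i → B.C i
  f_add : ∀ (i : ℤ) (x y : A.C i), f i (x + y) = f i x + f i y
  f_smul : ∀ (i : ℤ) (c : ℂ) (x : A.C i), f i (c • x) = c • f i x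
  f_one : f 0 A.one = B.one
  f_mul : ∀ {i j : ℤ} (x : A.C i) (y : A.C j), f (i + j) (A.mul x y) = B.mul (f i x) (f j y)
  f_d : ∀ {i : ℤ} (x : A.C i), f (i + 1) (A.d x) = B.d (f i x)

/-- A morphism of DG algebras is a quasi-isomorphism if it induces a bijection on
cohomology in every degree. -/
def IsQis {A B : DGA} (φ : DGAHom A B) : Prop :=
  ∀ i : ℤ,
    (∀ y : B.C i, B.d y = 0 → ∃ (x : A.C i) (w : B.C (i - 1)),
      A.d x = 0 ∧ φ.f i x = y + dcast B.C (by omega) (B.d w)) ∧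
    (∀ x : A.C i, A.d x = 0 →
      (∃ w : B.C (i - 1), φ.f i x = dcast B.C (by omega) (B.d w)) →
      ∃ v : A.C (i - 1), x = dcast A.C (by omega) (A.d v))

/-- The data of an isomorphism of graded algebras `H(A) ≅ ℂ[ι^{±1}]`, `|ι| = -2`:
cocycles `u k` representing the classes of `ι^k` which multiply correctly up to
coboundary, represent `1` in degree `0`, span the cohomology in each even degree,
are nonzero in cohomology, while the odd cohomology vanishes. -/
structure LaurentCohomology (A : DGA) where
  u : ∀ k : ℤ, A.C (-2 * k)
  hu : ∀ k : ℤ, A.d (u k) = 0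
  hone : ∃ w : A.C (-1), A.one = dcast A.C (by omega) (u 0) + dcast A.C (by omega) (A.d w)
  hmul : ∀ k l : ℤ, ∃ w : A.C (-2 * (k + l) - 1),
    dcast A.C (by ring) (A.mul (u k) (u l)) = u (k + l) + dcast A.C (by omega) (A.d w)
  hsurj : ∀ (k : ℤ) (x : A.C (-2 * k)), A.d x = 0 →
    ∃ (c : ℂ) (w : A.C (-2 * k - 1)), x = c • u k + dcast A.C (by omega) (A.d w)
  hodd : ∀ i : ℤ, ¬ Even i → ∀ x : A.C i, A.d x = 0 →
    ∃ w : A.C (i - 1), x = dcast A.C (by omega) (A.d w)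
  hfree : ∀ (k : ℤ) (c : ℂ),
    (∃ w : A.C (-2 * k - 1), c • u k = dcast A.C (by omega) (A.d w)) → c = 0

namespace IntrinsicFormality

section Transport

theorem coe_dcast {V : Type*} [AddCommGroup V] [Module ℂ V] (F : ℤ → Submodule ℂ V)
    {i j : ℤ} (h : i = j) (x : F i) : ((dcast (fun n => F n) h x : F j) : V) = x := by
  subst h; rfl

theorem coe_esign {V : Type*} [AddCommGroup V] [Module ℂ V] (F : Submodule ℂ V) (i : ℤ) (x : F) :
    ((esign i x : F) : V) = esign i (x : V) := by
  unfold esign; split <;> simp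

theorem esign_map {V W G : Type*} [AddCommGroup V] [AddCommGroup W] [FunLike G V W]
    [AddMonoidHomClass G V W] (f : G) (i : ℤ) (x : V) : f (esign i x) = esign i (f x) := by
  unfold esign; split <;> simp

end Transport

/-- A differential graded algebra presented by homogeneous subspaces of a single vector space
carrying a multiplication and a differential. -/
structure InternalDGA where
  T : Type
  [acg : AddCommGroup T]
  [mod : Module ℂ T]
  gr : ℤ → Submodule ℂ T
  one : T
  mul : T →ₗ[ℂ] T →ₗ[ℂ] T
  d : T →ₗ[ℂ] T
  one_mem : one ∈ gr 0
  mul_mem : ∀ {i j : ℤ} {x y : T}, x ∈ gr i → y ∈ gr j → mul x y ∈ gr (i + j)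
  d_mem : ∀ {i : ℤ} {x : T}, x ∈ gr i → d x ∈ gr (i + 1)
  one_mul : ∀ x, mul one x = x
  mul_one : ∀ x, mul x one = x
  mul_assoc : ∀ x y z, mul (mul x y) z = mul x (mul y z)
  d_d : ∀ {i : ℤ} {x : T}, x ∈ gr i → d (d x) = 0
  leibniz : ∀ {i j : ℤ} {x y : T}, x ∈ gr i → y ∈ gr j →
    d (mul x y) = mul (d x) y + esign i (mul x (d y))

attribute [instance] InternalDGA.acg InternalDGA.mod

/-- The differential graded algebra of homogeneous elements. -/
def InternalDGA.toDGA (S : InternalDGA) : DGA where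
  C i := S.gr i
  one := ⟨S.one, S.one_mem⟩
  mul x y := ⟨S.mul x y, S.mul_mem x.2 y.2⟩
  d x := ⟨S.d x, S.d_mem x.2⟩
  d_add x y := by ext; simp
  d_smul c x := by ext; simp
  d_d x := by ext; exact S.d_d x.2
  mul_add x y z := by ext; simp
  add_mul x y z := by ext; simp
  smul_mul c x y := by ext; simp
  mul_smul c x y := by ext; simp
  one_mul x := by ext; rw [coe_dcast]; exact S.one_mul _
  mul_one x := by ext; rw [coe_dcast]; exact S.mul_one _
  mul_assoc x y z := by ext; rw [coe_dcast]; exact S.mul_assoc _ _ _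
  leibniz {i j} x y := by
    ext
    rw [Submodule.coe_add, coe_dcast, coe_esign, coe_dcast]
    exact S.leibniz x.2 y.2

section GradedRing

variable {R : Type} [Ring R] [Algebra ℂ R]

/-- Homogeneous subspaces and a differential making a ring a differential graded algebra. -/
structure IsDifferential (F : ℤ → Submodule ℂ R) (d : R →ₗ[ℂ] R) : Prop where
  one_mem : 1 ∈ F 0
  mul_mem : ∀ {i j : ℤ} {x y : R}, x ∈ F i → y ∈ F j → x * y ∈ F (i + j)
  d_mem : ∀ {i : ℤ} {x : R}, x ∈ F i → d x ∈ F (i + 1)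
  d_d : ∀ {i : ℤ} {x : R}, x ∈ F i → d (d x) = 0
  leibniz : ∀ {i j : ℤ} {x y : R}, x ∈ F i → y ∈ F j →
    d (x * y) = d x * y + esign i (x * d y)

/-- The coboundaries of degree `n`. -/
def boundaries (F : ℤ → Submodule ℂ R) (d : R →ₗ[ℂ] R) (n : ℤ) : Submodule ℂ R :=
  (F (n - 1)).map d

/-- The elements `u k` are cocycles whose classes form a basis of the cohomology and
multiply like the powers of an invertible element of degree `-2`. -/
structure IsLaurentBasis (F : ℤ → Submodule ℂ R) (d : R →ₗ[ℂ] R) (u : ℤ → R) : Prop where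
  mem : ∀ k, u k ∈ F (-2 * k)
  d_eq_zero : ∀ k, d (u k) = 0
  one_sub_mem : 1 - u 0 ∈ boundaries F d 0
  mul_sub_mem : ∀ k l, u k * u l - u (k + l) ∈ boundaries F d (-2 * (k + l))
  exists_sub : ∀ k, ∀ x ∈ F (-2 * k), d x = 0 → ∃ c : ℂ, x - c • u k ∈ boundaries F d (-2 * k)
  odd : ∀ i, ¬ Even i → ∀ x ∈ F i, d x = 0 → x ∈ boundaries F d i
  free : ∀ (k : ℤ) (c : ℂ), c • u k ∈ boundaries F d (-2 * k) → c = 0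

variable {F : ℤ → Submodule ℂ R} {d : R →ₗ[ℂ] R} {u : ℤ → R}

theorem IsDifferential.mul_mem_boundaries (hd : IsDifferential F d) {i j n : ℤ} {x b : R}
    (hx : x ∈ F i) (hdx : d x = 0) (hb : b ∈ boundaries F d j) (hi : Even i) (hn : n = i + j) :
    x * b ∈ boundaries F d n := by
  obtain ⟨w, hw, rfl⟩ := hb
  refine ⟨x * w, ?_, ?_⟩
  · have := hd.mul_mem hx hw
    rwa [show i + (j - 1) = n - 1 by omega] at this
  · rw [hd.leibniz hx hw, hdx, esign, if_pos hi]; simp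

theorem IsDifferential.pow_mem (hd : IsDifferential F d) {i : ℤ} {x : R} (hx : x ∈ F i) (m : ℕ) :
    x ^ m ∈ F (m * i) := by
  induction m with
  | zero => simpa using hd.one_mem
  | succ m ih =>
    have := hd.mul_mem ih hx
    rw [pow_succ]
    convert this using 2
    push_cast; ring

theorem IsDifferential.d_one (hd : IsDifferential F d) : d 1 = 0 := by
  have := hd.leibniz hd.one_mem hd.one_mem
  simpa [esign] using this

theorem IsDifferential.d_pow_mul (hd : IsDifferential F d) {i j : ℤ} {x a : R} (hx : x ∈ F i)
    (hi : Even i) (hdx : d x = 0) (ha : a ∈ F j) (m : ℕ) : d (x ^ m * a) = x ^ m * d a := by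
  induction m with
  | zero => simp
  | succ m ih =>
    have h := hd.leibniz hx (hd.mul_mem (hd.pow_mem hx m) ha)
    rw [pow_succ', mul_assoc, h, hdx, ih, esign, if_pos hi]
    simp [mul_assoc]

theorem IsLaurentBasis.pow_mul_sub (hd : IsDifferential F d) (hu : IsLaurentBasis F d u)
    (m : ℕ) (k : ℤ) : u 1 ^ m * u k - u (k + m) ∈ boundaries F d (-2 * (k + m)) := by
  induction m with
  | zero => simp
  | succ m ih =>
    have h1 := hd.mul_mem_boundaries (n := -2 * (k + (m + 1 : ℕ))) (hu.mem 1) (hu.d_eq_zero 1) ih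
      (by decide) (by push_cast; ring)
    have h2 := hu.mul_sub_mem 1 (k + m)
    rw [show 1 + (k + (m : ℤ)) = k + (m + 1 : ℕ) by push_cast; ring] at h2
    convert add_mem h1 h2 using 1
    rw [pow_succ', mul_sub, mul_assoc]; abel

theorem IsLaurentBasis.pow_sub (hd : IsDifferential F d) (hu : IsLaurentBasis F d u) (m : ℕ) :
    u 1 ^ m - u m ∈ boundaries F d (-2 * m) := by
  have h1 := hu.pow_mul_sub hd m 0
  rw [zero_add] at h1
  have hm := hd.pow_mem (hu.mem 1) m
  have h2 := hd.mul_mem_boundaries (n := -2 * m) hm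
    (by simpa [hd.d_one] using hd.d_pow_mul (hu.mem 1) (by decide) (hu.d_eq_zero 1) hd.one_mem m)
    hu.one_sub_mem ⟨-m, by ring⟩ (by ring)
  convert add_mem h2 h1 using 1
  rw [mul_sub]; simp

end GradedRing

noncomputable section Telescope

open Filter LaurentPolynomial

variable {R : Type} [Ring R] [Algebra ℂ R]

/-- Germs at `+∞` of `ℤ`-indexed sequences. The right `R`-module
`colim (R → R → ⋯)` along left multiplication by `t` is realized as the germs
satisfying `f (k + 1) = t * f k`. -/
abbrev SeqGerm (R : Type) : Type := Germ (atTop : Filter ℤ) R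

theorem tendsto_add_atTop (k : ℤ) : Tendsto (fun j : ℤ => j + k) atTop atTop :=
  tendsto_atTop_add_const_right atTop k tendsto_id

/-- The shift of a germ by `k`. -/
def shift (k : ℤ) : SeqGerm R →ₗ[ℂ] SeqGerm R where
  toFun y := y.compTendsto _ (tendsto_add_atTop k)
  map_add' x y := by
    induction x, y using Germ.inductionOn₂; rfl
  map_smul' c x := by
    induction x using Germ.inductionOn; rfl

theorem shift_coe (k : ℤ) (f : ℤ → R) :
    shift k (f : SeqGerm R) = ((fun j => f (j + k) : ℤ → R) : SeqGerm R) := rfl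

/-- The action of Laurent polynomials on germs, the generator acting by the unit shift. -/
def shiftHom : ℂ[T;T⁻¹] →ₐ[ℂ] Module.End ℂ (SeqGerm R) :=
  AddMonoidAlgebra.lift ℂ (Module.End ℂ (SeqGerm R)) ℤ
    { toFun k := shift k.toAdd
      map_one' := by
        ext y
        induction y using Germ.inductionOn with | _ f => simp [shift_coe]
      map_mul' j k := by
        ext y
        induction y using Germ.inductionOn with
        | _ f =>
          refine congrArg Germ.ofFun (funext fun i => congrArg f ?_)
          rw [toAdd_mul]; ring }

theorem shiftHom_T (k : ℤ) : shiftHom (T k) = (shift k : SeqGerm R →ₗ[ℂ] SeqGerm R) := by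
  rw [shiftHom, T, AddMonoidAlgebra.lift_single, one_smul]
  rfl

theorem shiftHom_smul_T (c : ℂ) (k : ℤ) (y : SeqGerm R) : shiftHom (c • T k) y = c • shift k y := by
  rw [map_smul, shiftHom_T]; rfl

/-- A linear endomorphism applied termwise to germs. -/
def termwise (d : R →ₗ[ℂ] R) : SeqGerm R →ₗ[ℂ] SeqGerm R where
  toFun y := y.map d
  map_add' x y := by
    induction x, y using Germ.inductionOn₂
    exact congrArg Germ.ofFun (funext fun _ => map_add d _ _)
  map_smul' c x := by
    induction x using Germ.inductionOn
    exact congrArg Germ.ofFun (funext fun _ => map_smul d c _)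

theorem termwise_coe (d : R →ₗ[ℂ] R) (f : ℤ → R) :
    termwise d (f : SeqGerm R) = ((fun j => d (f j) : ℤ → R) : SeqGerm R) := rfl

theorem shift_termwise (k : ℤ) (d : R →ₗ[ℂ] R) (y : SeqGerm R) :
    shift k (termwise d y) = termwise d (shift k y) := by
  induction y using Germ.inductionOn; rfl

theorem shift_shift (j k : ℤ) (y : SeqGerm R) : shift j (shift k y) = shift (k + j) y := by
  induction y using Germ.inductionOn with
  | _ f => exact congrArg Germ.ofFun (funext fun i => congrArg f (by ring))

theorem shift_zero (y : SeqGerm R) : shift 0 y = y := by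
  induction y using Germ.inductionOn with
  | _ f => simp [shift_coe]

theorem shiftHom_termwise (e : ℂ[T;T⁻¹]) (d : R →ₗ[ℂ] R) (y : SeqGerm R) :
    shiftHom e (termwise d y) = termwise d (shiftHom e y) := by
  induction e using AddMonoidAlgebra.induction_linear with
  | zero => simp
  | add p q hp hq => simp [hp, hq]
  | single k c =>
    rw [show (AddMonoidAlgebra.single k c : ℂ[T;T⁻¹]) = c • T k by
      rw [T, AddMonoidAlgebra.smul_single, smul_eq_mul, mul_one]]
    rw [shiftHom_smul_T, shiftHom_smul_T, shift_termwise, LinearMap.map_smul]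

theorem shiftHom_mul_right (e : ℂ[T;T⁻¹]) (a : R) (y : SeqGerm R) :
    shiftHom e (y * (a : SeqGerm R)) = shiftHom e y * (a : SeqGerm R) := by
  have h (y : SeqGerm R) : y * (a : SeqGerm R) = termwise (LinearMap.mulRight ℂ a) y := by
    induction y using Germ.inductionOn; rfl
  rw [h, h, shiftHom_termwise]

/-- The germ of the sequence `t ^ k * a`. -/
def orbit (t : R) : R →ₗ[ℂ] SeqGerm R where
  toFun a := ((fun k : ℤ => t ^ k.toNat * a : ℤ → R) : SeqGerm R)
  map_add' _ _ := congrArg Germ.ofFun (funext fun _ => mul_add _ _ _)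
  map_smul' _ _ := congrArg Germ.ofFun (funext fun _ => mul_smul_comm _ _ _)

theorem orbit_apply (t a : R) :
    orbit t a = ((fun k : ℤ => t ^ k.toNat * a : ℤ → R) : SeqGerm R) := rfl

theorem orbit_mul (t a b : R) : orbit t a * (b : SeqGerm R) = orbit t (a * b) :=
  congrArg Germ.ofFun (funext fun _ => mul_assoc _ _ _)

theorem shift_orbit (t a : R) (m : ℕ) : shift m (orbit t a) = orbit t (t ^ m * a) := by
  rw [orbit_apply, orbit_apply, shift_coe, Germ.coe_eq]
  filter_upwards [eventually_ge_atTop 0] with k hk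
  rw [show (k + m).toNat = k.toNat + m by omega, pow_add, mul_assoc]

/-- A germ with `f (k + 1) = t * f k` from `K` on is a shifted orbit. -/
theorem coe_eq_shift_orbit (t : R) (f : ℤ → R) (K : ℤ) (hf : ∀ k ≥ K, f (k + 1) = t * f k) :
    (f : SeqGerm R) = shift (-K) (orbit t (f K)) := by
  rw [orbit_apply, shift_coe, Germ.coe_eq]
  have key (m : ℕ) : f (K + m) = t ^ m * f K := by
    induction m with
    | zero => simp
    | succ m ih =>
      rw [pow_succ', mul_assoc, ← ih, ← hf _ (by omega)]
      push_cast; rw [add_assoc]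
  filter_upwards [eventually_ge_atTop K] with k hk
  rw [← key, show K + ((k + -K).toNat : ℤ) = k by omega]

variable (F : ℤ → Submodule ℂ R) (t : R) in
/-- The degree `n` part of the telescope of left multiplication by `t`, `t` of degree `-2`. -/
def telescope (n : ℤ) : Submodule ℂ (SeqGerm R) where
  carrier := {y | ∃ f : ℤ → R, y = (f : SeqGerm R) ∧
    ∀ᶠ k in atTop, f k ∈ F (n - 2 * k) ∧ f (k + 1) = t * f k}
  zero_mem' := ⟨0, rfl, Eventually.of_forall fun k => by simp⟩
  add_mem' := by
    rintro _ _ ⟨f, rfl, hf⟩ ⟨g, rfl, hg⟩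
    refine ⟨f + g, rfl, ?_⟩
    filter_upwards [hf, hg] with k h1 h2
    exact ⟨add_mem h1.1 h2.1, by simp [h1.2, h2.2, mul_add]⟩
  smul_mem' := by
    rintro c _ ⟨f, rfl, hf⟩
    refine ⟨c • f, rfl, ?_⟩
    filter_upwards [hf] with k h1
    exact ⟨Submodule.smul_mem _ _ h1.1, by simp [h1.2]⟩

variable {F : ℤ → Submodule ℂ R} {d : R →ₗ[ℂ] R} {t : R}

theorem shift_mem_telescope {n m : ℤ} (k : ℤ) {y : SeqGerm R} (hy : y ∈ telescope F t n)
    (hm : m = n - 2 * k) : shift k y ∈ telescope F t m := by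
  obtain ⟨f, rfl, hf⟩ := hy
  refine ⟨_, shift_coe k f, ?_⟩
  filter_upwards [(tendsto_add_atTop k).eventually hf] with j hj
  refine ⟨?_, by rw [← hj.2]; congr 1; ring⟩
  convert hj.1 using 2
  subst hm; ring

theorem orbit_mem_telescope (hd : IsDifferential F d) (ht : t ∈ F (-2)) {n : ℤ} {a : R}
    (ha : a ∈ F n) : orbit t a ∈ telescope F t n := by
  refine ⟨_, rfl, ?_⟩
  filter_upwards [eventually_ge_atTop 0] with k hk
  constructor
  · convert hd.mul_mem (hd.pow_mem ht k.toNat) ha using 2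
    rw [Int.toNat_of_nonneg hk]; ring
  · rw [show (k + 1).toNat = k.toNat + 1 by omega, pow_succ', mul_assoc]

theorem mul_mem_telescope (hd : IsDifferential F d) {m n : ℤ} {y : SeqGerm R} {a : R}
    (hy : y ∈ telescope F t m) (ha : a ∈ F n) : y * (a : SeqGerm R) ∈ telescope F t (m + n) := by
  obtain ⟨f, rfl, hf⟩ := hy
  refine ⟨fun k => f k * a, rfl, ?_⟩
  filter_upwards [hf] with k hk
  refine ⟨?_, by rw [hk.2, mul_assoc]⟩
  convert hd.mul_mem hk.1 ha using 2
  ring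

theorem termwise_mem_telescope (hd : IsDifferential F d) (ht : t ∈ F (-2)) (hdt : d t = 0) {n : ℤ}
    {y : SeqGerm R} (hy : y ∈ telescope F t n) : termwise d y ∈ telescope F t (n + 1) := by
  obtain ⟨f, rfl, hf⟩ := hy
  refine ⟨fun k => d (f k), rfl, ?_⟩
  filter_upwards [hf] with k hk
  constructor
  · convert hd.d_mem hk.1 using 2
    ring
  · rw [hk.2]
    simpa using hd.d_pow_mul ht (by decide) hdt hk.1 1

theorem termwise_termwise (hd : IsDifferential F d) {n : ℤ}
    {y : SeqGerm R} (hy : y ∈ telescope F t n) : termwise d (termwise d y) = 0 := by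
  obtain ⟨f, rfl, hf⟩ := hy
  rw [termwise_coe, termwise_coe, ← Germ.coe_zero, Germ.coe_eq]
  filter_upwards [hf] with k hk
  exact hd.d_d hk.1

theorem termwise_mul (hd : IsDifferential F d) {m n : ℤ} {y : SeqGerm R} {a : R}
    (hy : y ∈ telescope F t m) (ha : a ∈ F n) :
    termwise d (y * (a : SeqGerm R)) =
      termwise d y * (a : SeqGerm R) + esign m (y * ((d a : R) : SeqGerm R)) := by
  obtain ⟨f, rfl, hf⟩ := hy
  have h : esign m ((f : SeqGerm R) * ((d a : R) : SeqGerm R)) =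
      ((fun k => esign m (f k * d a) : ℤ → R) : SeqGerm R) := by
    unfold esign; split <;> rfl
  rw [h]
  change ((fun k => d (f k * a) : ℤ → R) : SeqGerm R) =
    ((fun k => d (f k) * a + esign m (f k * d a) : ℤ → R) : SeqGerm R)
  rw [Germ.coe_eq]
  filter_upwards [hf] with k hk
  rw [hd.leibniz hk.1 ha]
  congr 1
  simp [esign, Int.even_sub]

theorem termwise_orbit (hd : IsDifferential F d) (ht : t ∈ F (-2)) (hdt : d t = 0) {n : ℤ} {a : R}
    (ha : a ∈ F n) : termwise d (orbit t a) = orbit t (d a) :=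
  congrArg Germ.ofFun (funext fun _ => hd.d_pow_mul ht (by decide) hdt ha _)

/-- The coboundaries of degree `n` in the telescope. -/
def telescopeBoundaries (F : ℤ → Submodule ℂ R) (d : R →ₗ[ℂ] R) (t : R) (n : ℤ) :
    Submodule ℂ (SeqGerm R) :=
  (telescope F t (n - 1)).map (termwise d)

theorem shift_mem_boundaries {n m : ℤ} (k : ℤ) {y : SeqGerm R}
    (hy : y ∈ telescopeBoundaries F d t n) (hm : m = n - 2 * k) :
    shift k y ∈ telescopeBoundaries F d t m := by
  obtain ⟨w, hw, rfl⟩ := hy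
  exact ⟨shift k w, shift_mem_telescope k hw (by omega), (shift_termwise k d w).symm⟩

theorem orbit_mem_boundaries (hd : IsDifferential F d) (ht : t ∈ F (-2)) (hdt : d t = 0) {n : ℤ}
    {b : R} (hb : b ∈ boundaries F d n) : orbit t b ∈ telescopeBoundaries F d t n := by
  obtain ⟨w, hw, rfl⟩ := hb
  exact ⟨orbit t w, orbit_mem_telescope hd ht hw, termwise_orbit hd ht hdt hw⟩

theorem eventually_mem_boundaries {n : ℤ} {f : ℤ → R}
    (hf : (f : SeqGerm R) ∈ telescopeBoundaries F d t n) :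
    ∀ᶠ k in atTop, f k ∈ boundaries F d (n - 2 * k) := by
  obtain ⟨_, ⟨g, rfl, hg⟩, h⟩ := hf
  rw [termwise_coe, Germ.coe_eq] at h
  filter_upwards [hg, h] with k hk h
  refine ⟨g k, ?_, h⟩
  convert hk.1 using 1
  rw [sub_right_comm]; rfl

end Telescope

noncomputable section Comparison

open Filter LaurentPolynomial

/-- The Laurent polynomials of degree `n`, the generator having degree `-2`. -/
def laurentGr (n : ℤ) : Submodule ℂ ℂ[T;T⁻¹] where
  carrier := {p | ∀ k, n ≠ -2 * k → p.coeff k = 0}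
  zero_mem' := fun k _ => rfl
  add_mem' := fun {p q} hp hq k hk => by simp [hp k hk, hq k hk]
  smul_mem' := fun c p hp k hk => by simp [hp k hk]

theorem T_mem_laurentGr {n k : ℤ} (h : n = -2 * k) : (T k : ℂ[T;T⁻¹]) ∈ laurentGr n := by
  intro j hj
  rw [T_apply, if_neg]
  rintro rfl
  exact hj h

theorem eq_smul_T {n k : ℤ} (h : n = -2 * k) {p : ℂ[T;T⁻¹]} (hp : p ∈ laurentGr n) :
    p = p.coeff k • T k := by
  ext j
  by_cases hj : k = j
  · subst hj; simp
  · have := hp j (by omega)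
    simp [hj, this]

theorem eq_zero_of_not_even {n : ℤ} (h : ¬ Even n) {p : ℂ[T;T⁻¹]} (hp : p ∈ laurentGr n) :
    p = 0 := by
  ext j
  refine hp j ?_
  rintro rfl
  exact h ⟨-j, by ring⟩

theorem exists_eq_neg_two_mul {n : ℤ} (h : Even n) : ∃ k, n = -2 * k := by
  obtain ⟨m, rfl⟩ := h
  exact ⟨-m, by ring⟩

theorem mul_mem_laurentGr {m n : ℤ} {p q : ℂ[T;T⁻¹]} (hp : p ∈ laurentGr m)
    (hq : q ∈ laurentGr n) : p * q ∈ laurentGr (m + n) := by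
  by_cases hm : Even m
  · by_cases hn : Even n
    · obtain ⟨j, rfl⟩ := exists_eq_neg_two_mul hm
      obtain ⟨k, rfl⟩ := exists_eq_neg_two_mul hn
      rw [eq_smul_T rfl hp, eq_smul_T rfl hq, smul_mul_smul_comm, ← T_add]
      exact Submodule.smul_mem _ _ (T_mem_laurentGr (by ring))
    · simp [eq_zero_of_not_even hn hq]
  · simp [eq_zero_of_not_even hm hp]

variable {R : Type} [Ring R] [Algebra ℂ R] {F : ℤ → Submodule ℂ R} {d : R →ₗ[ℂ] R} {u : ℤ → R}

theorem shiftHom_mem_telescope {t : R} {m n : ℤ} {e : ℂ[T;T⁻¹]} {y : SeqGerm R}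
    (he : e ∈ laurentGr m) (hy : y ∈ telescope F t n) : shiftHom e y ∈ telescope F t (m + n) := by
  by_cases hm : Even m
  · obtain ⟨k, rfl⟩ := exists_eq_neg_two_mul hm
    rw [eq_smul_T rfl he, shiftHom_smul_T]
    exact Submodule.smul_mem _ _ (shift_mem_telescope k hy (by ring))
  · simp [eq_zero_of_not_even hm he]

theorem IsLaurentBasis.mem_one (hu : IsLaurentBasis F d u) : u 1 ∈ F (-2) := by
  simpa using hu.mem 1

/-- The unit of `R` in the telescope of left multiplication by `u 1`. -/
abbrev baseGerm (u : ℤ → R) : SeqGerm R := orbit (u 1) 1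

theorem termwise_baseGerm (hd : IsDifferential F d) (hu : IsLaurentBasis F d u) :
    termwise d (baseGerm u) = 0 := by
  rw [termwise_orbit hd hu.mem_one (hu.d_eq_zero 1) hd.one_mem, hd.d_one, map_zero]

theorem shift_baseGerm_sub (hd : IsDifferential F d) (hu : IsLaurentBasis F d u) (k : ℤ) :
    shift k (baseGerm u) - orbit (u 1) (u k) ∈ telescopeBoundaries F d (u 1) (-2 * k) := by
  obtain ⟨m, j, hj⟩ : ∃ m j : ℕ, k + m = j := ⟨k.natAbs, (k + k.natAbs).toNat, by omega⟩
  have h1 : shift k (baseGerm u) = shift (-m) (orbit (u 1) (u 1 ^ j)) := by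
    rw [← mul_one (u 1 ^ j), ← shift_orbit, shift_shift, ← hj, add_neg_cancel_right]
  have h2 : orbit (u 1) (u k) = shift (-m) (orbit (u 1) (u 1 ^ m * u k)) := by
    rw [← shift_orbit, shift_shift, add_neg_cancel, shift_zero]
  rw [h1, h2, ← map_sub, ← map_sub]
  refine shift_mem_boundaries (n := -2 * j) _
    (orbit_mem_boundaries hd hu.mem_one (hu.d_eq_zero 1) ?_) (by rw [← hj]; ring)
  have h3 := hu.pow_mul_sub hd m k
  rw [hj] at h3
  simpa using sub_mem (hu.pow_sub hd j) h3

theorem exists_orbit_sub (hd : IsDifferential F d) (hu : IsLaurentBasis F d u) {n : ℤ}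
    {e : ℂ[T;T⁻¹]} (he : e ∈ laurentGr n) :
    ∃ a ∈ F n, d a = 0 ∧
      shiftHom e (baseGerm u) - orbit (u 1) a ∈ telescopeBoundaries F d (u 1) n := by
  by_cases hn : Even n
  · obtain ⟨k, rfl⟩ := exists_eq_neg_two_mul hn
    refine ⟨e.coeff k • u k, Submodule.smul_mem _ _ (hu.mem k), by simp [hu.d_eq_zero], ?_⟩
    rw [eq_smul_T rfl he, shiftHom_smul_T, map_smul, ← eq_smul_T rfl he, ← smul_sub]
    exact Submodule.smul_mem _ _ (shift_baseGerm_sub hd hu k)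
  · exact ⟨0, zero_mem _, map_zero _, by simp [eq_zero_of_not_even hn he]⟩

/-- Every cocycle of the telescope is cohomologous to a multiple of the unit. -/
theorem exists_sub_shiftHom (hd : IsDifferential F d) (hu : IsLaurentBasis F d u) {n : ℤ}
    {z : SeqGerm R} (hz : z ∈ telescope F (u 1) n) (hdz : termwise d z = 0) :
    ∃ e ∈ laurentGr n, z - shiftHom e (baseGerm u) ∈ telescopeBoundaries F d (u 1) n := by
  obtain ⟨f, rfl, hf⟩ := hz
  rw [termwise_coe, ← Germ.coe_zero, Germ.coe_eq] at hdz
  obtain ⟨K, hK⟩ := eventually_atTop.1 (hf.and hdz)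
  rw [coe_eq_shift_orbit (u 1) f K fun k hk => (hK k hk).1.2]
  have hmem := (hK K le_rfl).1.1
  have hcl : d (f K) = 0 := (hK K le_rfl).2
  generalize f K = a at hmem hcl
  by_cases hn : Even n
  · obtain ⟨l, rfl⟩ := exists_eq_neg_two_mul hn
    rw [show -2 * l - 2 * K = -2 * (l + K) by ring] at hmem
    obtain ⟨c, hc⟩ := hu.exists_sub _ a hmem hcl
    refine ⟨c • T l, Submodule.smul_mem _ _ (T_mem_laurentGr rfl), ?_⟩
    have h1 := shift_mem_boundaries (m := -2 * l) (-K)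
      (orbit_mem_boundaries hd hu.mem_one (hu.d_eq_zero 1) hc) (by ring)
    have h2 := shift_mem_boundaries (m := -2 * l) (-K) (shift_baseGerm_sub hd hu (l + K)) (by ring)
    convert sub_mem h1 (Submodule.smul_mem _ c h2) using 1
    rw [shiftHom_smul_T, map_sub, map_sub, map_sub, shift_shift, add_neg_cancel_right, map_smul,
      LinearMap.map_smul, smul_sub]
    abel
  · refine ⟨0, zero_mem _, ?_⟩
    rw [map_zero, LinearMap.zero_apply, sub_zero]
    refine shift_mem_boundaries (-K) (orbit_mem_boundaries hd hu.mem_one (hu.d_eq_zero 1)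
      (hu.odd _ ?_ a hmem hcl)) (by ring)
    simpa [Int.even_sub] using hn

theorem eq_zero_of_shiftHom_mem (hd : IsDifferential F d) (hu : IsLaurentBasis F d u) {n : ℤ}
    {e : ℂ[T;T⁻¹]} (he : e ∈ laurentGr n)
    (h : shiftHom e (baseGerm u) ∈ telescopeBoundaries F d (u 1) n) : e = 0 := by
  by_cases hn : Even n
  · obtain ⟨k, rfl⟩ := exists_eq_neg_two_mul hn
    rw [eq_smul_T rfl he, shiftHom_smul_T] at h
    have h1 := shift_mem_boundaries (m := 0) (-k) h (by ring)
    rw [LinearMap.map_smul, shift_shift, add_neg_cancel, shift_zero, ← map_smul, orbit_apply] at h1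
    obtain ⟨j, h2, hj⟩ := ((eventually_mem_boundaries h1).and (eventually_ge_atTop 0)).exists
    lift j to ℕ using hj
    rw [Int.toNat_natCast, mul_smul_comm, mul_one, show (0 : ℤ) - 2 * j = -2 * j by ring] at h2
    have h3 := sub_mem h2 (Submodule.smul_mem _ (e.coeff k) (hu.pow_sub hd j))
    rw [smul_sub, sub_sub_cancel] at h3
    rw [eq_smul_T rfl he, hu.free j _ h3, zero_smul]
  · exact eq_zero_of_not_even hn he

theorem mem_boundaries_of_orbit (hd : IsDifferential F d) (hu : IsLaurentBasis F d u) {n : ℤ}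
    {a : R} (ha : a ∈ F n) (hda : d a = 0)
    (h : orbit (u 1) a ∈ telescopeBoundaries F d (u 1) n) : a ∈ boundaries F d n := by
  by_cases hn : Even n
  · obtain ⟨k, rfl⟩ := exists_eq_neg_two_mul hn
    obtain ⟨c, hc⟩ := hu.exists_sub k a ha hda
    have h1 := sub_mem h (orbit_mem_boundaries hd hu.mem_one (hu.d_eq_zero 1) hc)
    have h2 := add_mem h1 (Submodule.smul_mem _ c (shift_baseGerm_sub hd hu k))
    rw [← map_sub, sub_sub_cancel, map_smul, smul_sub, add_sub_cancel, ← shiftHom_smul_T] at h2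
    have h3 := eq_zero_of_shiftHom_mem hd hu (Submodule.smul_mem _ c (T_mem_laurentGr rfl)) h2
    have h4 := congrArg (fun p => p.coeff k) h3
    have hc0 : c = 0 := by simpa using h4
    simpa [hc0] using hc
  · exact hu.odd n hn a ha hda

/-- The Laurent polynomial ring with zero differential. -/
def laurentInternal : InternalDGA where
  T := ℂ[T;T⁻¹]
  gr := laurentGr
  one := 1
  mul := LinearMap.mul ℂ _
  d := 0
  one_mem := by rw [← T_zero]; exact T_mem_laurentGr (by simp)
  mul_mem hx hy := mul_mem_laurentGr hx hy
  d_mem _ := zero_mem _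
  one_mul := one_mul
  mul_one := mul_one
  mul_assoc := mul_assoc
  d_d _ := rfl
  leibniz _ _ := by simp [esign]

theorem smul_mul_const (c : ℂ) (y : SeqGerm R) (a : R) :
    c • y * (a : SeqGerm R) = c • (y * (a : SeqGerm R)) := by
  induction y using Germ.inductionOn with
  | _ f => exact congrArg Germ.ofFun (funext fun _ => smul_mul_assoc _ _ _)

theorem mul_const_smul (c : ℂ) (y : SeqGerm R) (a : R) :
    y * ((c • a : R) : SeqGerm R) = c • (y * (a : SeqGerm R)) := by
  induction y using Germ.inductionOn with
  | _ f => exact congrArg Germ.ofFun (funext fun _ => mul_smul_comm _ _ _)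

theorem mul_const_add {S : Type} [Ring S] (y : SeqGerm S) (a b : S) :
    y * ((a + b : S) : SeqGerm S) = y * (a : SeqGerm S) + y * (b : SeqGerm S) :=
  mul_add y (a : SeqGerm S) b

theorem mul_const_mul {S : Type} [Ring S] (y : SeqGerm S) (a b : S) :
    y * ((a * b : S) : SeqGerm S) = y * (a : SeqGerm S) * (b : SeqGerm S) :=
  (mul_assoc y (a : SeqGerm S) b).symm

theorem mul_const_one {S : Type} [Ring S] (y : SeqGerm S) : y * ((1 : S) : SeqGerm S) = y :=
  mul_one y

/-- Multiplication of triangular matrices with diagonal entries in the Laurent polynomial ring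
and `R` and off-diagonal entry a germ. -/
def fibreMul (R : Type) [Ring R] [Algebra ℂ R] :
    (ℂ[T;T⁻¹] × R × SeqGerm R) →ₗ[ℂ] (ℂ[T;T⁻¹] × R × SeqGerm R) →ₗ[ℂ]
      (ℂ[T;T⁻¹] × R × SeqGerm R) :=
  LinearMap.mk₂ ℂ
    (fun p q => (p.1 * q.1, p.2.1 * q.2.1, shiftHom p.1 q.2.2 + p.2.2 * (q.2.1 : SeqGerm R)))
    (fun p p' q => by
      refine Prod.ext (add_mul _ _ _) (Prod.ext (add_mul _ _ _) ?_)
      simp only [Prod.fst_add, Prod.snd_add, map_add, LinearMap.add_apply, add_mul]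
      abel)
    (fun c p q => by
      refine Prod.ext (smul_mul_assoc _ _ _) (Prod.ext (smul_mul_assoc _ _ _) ?_)
      simp only [Prod.smul_fst, Prod.smul_snd, map_smul, LinearMap.smul_apply, smul_mul_const,
        smul_add])
    (fun p q q' => by
      refine Prod.ext (mul_add _ _ _) (Prod.ext (mul_add _ _ _) ?_)
      simp only [Prod.fst_add, Prod.snd_add, map_add, mul_const_add]
      abel)
    (fun c p q => by
      refine Prod.ext (mul_smul_comm _ _ _) (Prod.ext (mul_smul_comm _ _ _) ?_)
      simp only [Prod.smul_fst, Prod.smul_snd, LinearMap.map_smul, mul_const_smul, smul_add])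

theorem fibreMul_apply (e e' : ℂ[T;T⁻¹]) (a a' : R) (y y' : SeqGerm R) :
    fibreMul R (e, a, y) (e', a', y') =
      (e * e', a * a', shiftHom e y' + y * (a' : SeqGerm R)) := rfl

/-- The differential on triangular matrices, twisted by the base germ. -/
def fibreD (d : R →ₗ[ℂ] R) (u : ℤ → R) :
    (ℂ[T;T⁻¹] × R × SeqGerm R) →ₗ[ℂ] (ℂ[T;T⁻¹] × R × SeqGerm R) :=
  LinearMap.prod 0 (LinearMap.prod (d ∘ₗ LinearMap.fst ℂ _ _ ∘ₗ LinearMap.snd ℂ _ _)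
    ((shiftHom (R := R)).toLinearMap.flip (baseGerm u) ∘ₗ LinearMap.fst ℂ _ _ -
      orbit (u 1) ∘ₗ LinearMap.fst ℂ _ _ ∘ₗ LinearMap.snd ℂ _ _ -
      termwise d ∘ₗ LinearMap.snd ℂ _ _ ∘ₗ LinearMap.snd ℂ _ _))

theorem fibreD_apply (e : ℂ[T;T⁻¹]) (a : R) (y : SeqGerm R) :
    fibreD d u (e, a, y) =
      (0, d a, shiftHom e (baseGerm u) - orbit (u 1) a - termwise d y) := rfl

/-- The homotopy fibre product of the Laurent polynomial ring and `R` over the telescope: the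
triangular matrices with these diagonal entries and off-diagonal entry in the telescope. -/
def fibreInternal (hd : IsDifferential F d) (hu : IsLaurentBasis F d u) : InternalDGA where
  T := ℂ[T;T⁻¹] × R × SeqGerm R
  gr n := (laurentGr n).prod ((F n).prod (telescope F (u 1) (n - 1)))
  one := (1, 1, 0)
  mul := fibreMul R
  d := fibreD d u
  one_mem := ⟨laurentInternal.one_mem, hd.one_mem, zero_mem _⟩
  mul_mem {i j} := by
    rintro ⟨e, a, y⟩ ⟨e', a', y'⟩ ⟨he, ha, hy⟩ ⟨he', ha', hy'⟩
    refine ⟨mul_mem_laurentGr he he', hd.mul_mem ha ha', add_mem ?_ ?_⟩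
    · have := shiftHom_mem_telescope he hy'
      rwa [← add_sub_assoc] at this
    · have := mul_mem_telescope hd hy ha'
      rwa [sub_add_eq_add_sub] at this
  d_mem {i} := by
    rintro ⟨e, a, y⟩ ⟨he, ha, hy⟩
    refine ⟨zero_mem _, hd.d_mem ha, ?_⟩
    rw [show i + 1 - 1 = i by ring]
    refine sub_mem (sub_mem ?_ (orbit_mem_telescope hd hu.mem_one ha)) ?_
    · have := shiftHom_mem_telescope he
        (orbit_mem_telescope (t := u 1) hd hu.mem_one hd.one_mem)
      rwa [add_zero] at this
    · have := termwise_mem_telescope hd hu.mem_one (hu.d_eq_zero 1) hy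
      rwa [sub_add_cancel] at this
  one_mul := by
    rintro ⟨e, a, y⟩
    rw [fibreMul_apply, one_mul, one_mul, map_one, zero_mul, add_zero]
    rfl
  mul_one := by
    rintro ⟨e, a, y⟩
    rw [fibreMul_apply, mul_one, mul_one, map_zero, mul_const_one, zero_add]
  mul_assoc := by
    rintro ⟨e, a, y⟩ ⟨e', a', y'⟩ ⟨e'', a'', y''⟩
    simp only [fibreMul_apply, mul_assoc, map_mul, map_add, add_mul, mul_const_mul,
      shiftHom_mul_right, Module.End.mul_apply, add_assoc]
  d_d {i} := by
    rintro ⟨e, a, y⟩ ⟨he, ha, hy⟩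
    have hy' := termwise_termwise hd hy
    simp only [fibreD_apply, map_sub, hy', hd.d_d ha, ← shiftHom_termwise,
      termwise_baseGerm hd hu, termwise_orbit hd hu.mem_one (hu.d_eq_zero 1) ha]
    simp
  leibniz {i j} := by
    rintro ⟨e, a, y⟩ ⟨e', a', y'⟩ ⟨he, ha, hy⟩ ⟨he', ha', hy'⟩
    have h := termwise_mul hd hy ha'
    have h' := hd.leibniz ha ha'
    dsimp only at he ha hy he' ha' hy'
    simp only [fibreMul_apply, fibreD_apply]
    have hx : shiftHom e (baseGerm u) * (a' : SeqGerm R) = shiftHom e (orbit (u 1) a') := by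
      rw [← shiftHom_mul_right, orbit_mul, one_mul]
    by_cases hi : Even i
    · have hi' : ¬ Even (i - 1) := by simpa [Int.even_sub] using hi
      rw [esign, if_neg hi'] at h
      rw [esign, if_pos hi] at h' ⊢
      refine Prod.ext (by simp) (Prod.ext h' ?_)
      simp only [Prod.snd_add, map_sub, map_add, map_mul, map_zero, LinearMap.zero_apply,
        Module.End.mul_apply, sub_mul, h, hx, orbit_mul, shiftHom_termwise]
      abel
    · have hi' : Even (i - 1) := by simpa [Int.even_sub] using hi
      rw [esign, if_pos hi'] at h
      rw [esign, if_neg hi] at h' ⊢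
      rw [eq_zero_of_not_even hi he] at hx ⊢
      refine Prod.ext (by simp) (Prod.ext h' ?_)
      simp only [Prod.snd_add, Prod.snd_neg, map_sub, map_add, map_zero,
        LinearMap.zero_apply, sub_mul, h, orbit_mul, zero_mul]
      abel

/-- A cocycle with vanishing first entry and exact second entry is exact. -/
theorem exists_fibreD_eq (hd : IsDifferential F d) (hu : IsLaurentBasis F d u) {n : ℤ} {a : R}
    {y : SeqGerm R} (ha : a ∈ boundaries F d n) (hy : y ∈ telescope F (u 1) (n - 1))
    (h : fibreD d u (0, a, y) = 0) :
    ∃ v ∈ (fibreInternal hd hu).gr (n - 1), fibreD d u v = (0, a, y) := by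
  obtain ⟨w, hw, rfl⟩ := ha
  have hdo := termwise_orbit hd hu.mem_one (hu.d_eq_zero 1) hw
  have hc : termwise d (y + orbit (u 1) w) = 0 := by
    rw [fibreD_apply, map_zero, LinearMap.zero_apply, Prod.mk_eq_zero, Prod.mk_eq_zero] at h
    rw [map_add, hdo, ← neg_eq_zero, ← h.2.2]
    abel
  obtain ⟨e, he, y', hy', h'⟩ := exists_sub_shiftHom hd hu
    (add_mem hy (orbit_mem_telescope hd hu.mem_one hw)) hc
  refine ⟨(e, w, -y'), ⟨he, hw, neg_mem hy'⟩, ?_⟩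
  rw [fibreD_apply, map_neg, h']
  simp

theorem eq_zero_iff_mem_boundaries (hd : IsDifferential F d) (hu : IsLaurentBasis F d u) {n : ℤ}
    {e : ℂ[T;T⁻¹]} {a : R} {y : SeqGerm R} (hx : (e, a, y) ∈ (fibreInternal hd hu).gr n)
    (h : fibreD d u (e, a, y) = 0) : e = 0 ↔ a ∈ boundaries F d n := by
  obtain ⟨he, ha, hy⟩ := hx
  rw [fibreD_apply, Prod.mk_eq_zero, Prod.mk_eq_zero, sub_eq_zero] at h
  have hmem : shiftHom e (baseGerm u) - orbit (u 1) a ∈ telescopeBoundaries F d (u 1) n :=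
    ⟨y, hy, h.2.2.symm⟩
  constructor
  · rintro rfl
    rw [map_zero, LinearMap.zero_apply, zero_sub, neg_mem_iff] at hmem
    exact mem_boundaries_of_orbit hd hu ha h.2.1 hmem
  · intro hb
    refine eq_zero_of_shiftHom_mem hd hu he ?_
    simpa using add_mem hmem (orbit_mem_boundaries hd hu.mem_one (hu.d_eq_zero 1) hb)

theorem exists_cocycle_of_laurent (hd : IsDifferential F d) (hu : IsLaurentBasis F d u) {n : ℤ}
    {e : ℂ[T;T⁻¹]} (he : e ∈ laurentGr n) :
    ∃ x ∈ (fibreInternal hd hu).gr n, fibreD d u x = 0 ∧ x.1 = e := by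
  obtain ⟨a, ha, hda, y, hy, h⟩ := exists_orbit_sub hd hu he
  exact ⟨(e, a, y), ⟨he, ha, hy⟩, by rw [fibreD_apply, hda, h, sub_self]; rfl, rfl⟩

theorem exists_cocycle_of_cocycle (hd : IsDifferential F d) (hu : IsLaurentBasis F d u) {n : ℤ}
    {a : R} (ha : a ∈ F n) (hda : d a = 0) :
    ∃ x ∈ (fibreInternal hd hu).gr n, fibreD d u x = 0 ∧ x.2.1 = a := by
  obtain ⟨e, he, y, hy, h⟩ := exists_sub_shiftHom hd hu
    (orbit_mem_telescope (t := u 1) hd hu.mem_one ha)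
    (by rw [termwise_orbit hd hu.mem_one (hu.d_eq_zero 1) ha, hda, map_zero])
  refine ⟨(e, a, -y), ⟨he, ha, neg_mem hy⟩, ?_, rfl⟩
  rw [fibreD_apply, hda, map_neg, h]
  simp

end Comparison

noncomputable section Total

open DirectSum

variable (A : DGA)

theorem mk_eq_mk_of_dcast {C : ℤ → Type} {i j : ℤ} (h : i = j) {x : C i} {y : C j}
    (hxy : dcast C h x = y) : GradedMonoid.mk i x = GradedMonoid.mk j y := by
  subst h; subst hxy; rfl

instance gMul : GradedMonoid.GMul A.C where
  mul := A.mul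

instance gOne : GradedMonoid.GOne A.C where
  one := A.one

instance gMonoid : GradedMonoid.GMonoid A.C where
  one_mul x := mk_eq_mk_of_dcast _ (A.one_mul x.2)
  mul_one x := mk_eq_mk_of_dcast _ (A.mul_one x.2)
  mul_assoc x y z := mk_eq_mk_of_dcast _ (A.mul_assoc x.2 y.2 z.2)

instance gRing : GRing A.C where
  mul_zero {i j} a := by
    change A.mul a 0 = 0
    simpa using A.mul_smul 0 a (0 : A.C j)
  zero_mul {i j} b := by
    change A.mul 0 b = 0
    simpa using A.smul_mul 0 (0 : A.C i) b
  mul_add := A.mul_add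
  add_mul := A.add_mul
  natCast n := n • A.one
  natCast_zero := zero_smul _ _
  natCast_succ n := succ_nsmul _ _
  intCast n := n • A.one
  intCast_ofNat n := natCast_zsmul _ _
  intCast_negSucc_ofNat n := negSucc_zsmul _ _

theorem of_mul_of_total {i j : ℤ} (x : A.C i) (y : A.C j) :
    of A.C i x * of A.C j y = of A.C (i + j) (A.mul x y) :=
  of_mul_of x y

theorem smul_of {i : ℤ} (c : ℂ) (x : A.C i) : c • of A.C i x = of A.C i (c • x) :=
  ((lof ℂ ℤ A.C i).map_smul c x).symm

theorem of_dcast {i j : ℤ} (h : i = j) (x : A.C i) : of A.C j (dcast A.C h x) = of A.C i x := by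
  subst h; rfl

instance totalAlgebra : Algebra ℂ (⨁ i, A.C i) :=
  Algebra.ofModule
    (fun c x y => by
      induction x using DirectSum.induction_on with
      | zero => simp
      | add x x' hx hx' => simp only [smul_add, add_mul, hx, hx']
      | of i x =>
        induction y using DirectSum.induction_on with
        | zero => simp
        | add y y' hy hy' => simp only [smul_add, mul_add, hy, hy']
        | of j y => rw [smul_of, of_mul_of_total, of_mul_of_total, A.smul_mul, smul_of])
    (fun c x y => by
      induction x using DirectSum.induction_on with
      | zero => simp
      | add x x' hx hx' => simp only [smul_add, add_mul, hx, hx']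
      | of i x =>
        induction y using DirectSum.induction_on with
        | zero => simp
        | add y y' hy hy' => simp only [smul_add, mul_add, hy, hy']
        | of j y => rw [smul_of, of_mul_of_total, of_mul_of_total, A.mul_smul, smul_of])

/-- The homogeneous subspaces of the total space. -/
def totalGr (i : ℤ) : Submodule ℂ (⨁ i, A.C i) := LinearMap.range (lof ℂ ℤ A.C i)

/-- The differential on the total space. -/
def totalD : (⨁ i, A.C i) →ₗ[ℂ] ⨁ i, A.C i :=
  toModule ℂ ℤ _ fun i => lof ℂ ℤ A.C (i + 1) ∘ₗ ⟨⟨A.d, A.d_add⟩, A.d_smul⟩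

theorem totalD_of {i : ℤ} (x : A.C i) : totalD A (of A.C i x) = of A.C (i + 1) (A.d x) :=
  toModule_lof ℂ i x

theorem of_mem {i : ℤ} (x : A.C i) : of A.C i x ∈ totalGr A i := ⟨x, rfl⟩

theorem exists_of {i : ℤ} {x : ⨁ i, A.C i} (hx : x ∈ totalGr A i) : ∃ a, of A.C i a = x := hx

theorem of_apply_of_mem {i : ℤ} {x : ⨁ i, A.C i} (hx : x ∈ totalGr A i) : of A.C i (x i) = x := by
  obtain ⟨a, rfl⟩ := exists_of A hx
  rw [of_eq_same]

theorem of_eq_zero {i : ℤ} {x : A.C i} : of A.C i x = 0 ↔ x = 0 :=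
  map_eq_zero_iff _ (of_injective i)

theorem d_zero {i : ℤ} : A.d (0 : A.C i) = 0 := by
  simpa using A.d_smul 0 (0 : A.C i)

theorem isDifferential_total : IsDifferential (totalGr A) (totalD A) where
  one_mem := of_mem A A.one
  mul_mem := by
    rintro i j _ _ ⟨x, rfl⟩ ⟨y, rfl⟩
    exact ⟨A.mul x y, (of_mul_of_total A x y).symm⟩
  d_mem := by
    rintro i _ ⟨x, rfl⟩
    exact ⟨A.d x, (totalD_of A x).symm⟩
  d_d := by
    rintro i _ ⟨x, rfl⟩
    change totalD A (totalD A (of A.C i x)) = 0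
    rw [totalD_of, totalD_of, A.d_d, map_zero]
  leibniz := by
    rintro i j _ _ ⟨x, rfl⟩ ⟨y, rfl⟩
    change totalD A (of A.C i x * of A.C j y) =
      totalD A (of A.C i x) * of A.C j y + esign i (of A.C i x * totalD A (of A.C j y))
    rw [of_mul_of_total, totalD_of, totalD_of, totalD_of, of_mul_of_total, of_mul_of_total,
      A.leibniz, map_add, esign_map, of_dcast, of_dcast]

theorem of_mem_boundaries_iff {i : ℤ} (x : A.C i) :
    of A.C i x ∈ boundaries (totalGr A) (totalD A) i ↔
      ∃ w : A.C (i - 1), x = dcast A.C (by omega) (A.d w) := by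
  constructor
  · rintro ⟨_, ⟨w, rfl⟩, h⟩
    refine ⟨w, of_injective i ?_⟩
    rw [of_dcast, ← totalD_of]
    exact h.symm
  · rintro ⟨w, rfl⟩
    exact ⟨of A.C _ w, of_mem A w, by rw [totalD_of, of_dcast]⟩

theorem isLaurentBasis_total (h : LaurentCohomology A) :
    IsLaurentBasis (totalGr A) (totalD A) fun k => of A.C _ (h.u k) where
  mem k := of_mem A _
  d_eq_zero k := by rw [totalD_of, h.hu, map_zero]
  one_sub_mem := by
    obtain ⟨w, hw⟩ := h.hone
    rw [one_def]
    refine ⟨of A.C (-1) w, of_mem A w, ?_⟩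
    rw [totalD_of]
    change _ = of A.C 0 A.one - _
    rw [hw, map_add, of_dcast, of_dcast, add_sub_cancel_left]
  mul_sub_mem k l := by
    obtain ⟨w, hw⟩ := h.hmul k l
    refine ⟨of A.C _ w, of_mem A w, ?_⟩
    rw [of_mul_of_total, ← of_dcast A (show -2 * k + -2 * l = -2 * (k + l) by ring), hw, map_add,
      of_dcast, totalD_of, add_sub_cancel_left]
  exists_sub k := by
    rintro _ ⟨x, rfl⟩ hx
    change totalD A (of A.C _ x) = 0 at hx
    rw [totalD_of, of_eq_zero] at hx
    obtain ⟨c, w, hw⟩ := h.hsurj k x hx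
    refine ⟨c, of A.C _ w, of_mem A w, ?_⟩
    change _ = of A.C _ x - _
    rw [hw, map_add, smul_of, of_dcast, totalD_of, add_sub_cancel_left]
  odd i hi := by
    rintro _ ⟨x, rfl⟩ hx
    change totalD A (of A.C _ x) = 0 at hx
    rw [totalD_of, of_eq_zero] at hx
    exact (of_mem_boundaries_iff A x).2 (h.hodd i hi x hx)
  free k c hc := by
    rw [smul_of, of_mem_boundaries_iff] at hc
    exact h.hfree k c hc

variable {A} (h : LaurentCohomology A)

/-- The roof of the formality zigzag. -/
abbrev roofInternal : InternalDGA :=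
  fibreInternal (isDifferential_total A) (isLaurentBasis_total A h)

/-- The projection of the roof to the given differential graded algebra. -/
def roofToDGA : DGAHom (roofInternal h).toDGA A where
  f i x := x.1.2.1 i
  f_add _ _ _ := rfl
  f_smul _ _ _ := rfl
  f_one := of_eq_same 0 A.one
  f_mul {i j} x y := by
    apply of_injective (i + j)
    rw [← of_mul_of_total, of_apply_of_mem A x.2.2.1, of_apply_of_mem A y.2.2.1]
    exact of_apply_of_mem A ((isDifferential_total A).mul_mem x.2.2.1 y.2.2.1)
  f_d {i} x := by
    apply of_injective (i + 1)
    rw [← totalD_of, of_apply_of_mem A x.2.2.1]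
    exact of_apply_of_mem A ((isDifferential_total A).d_mem x.2.2.1)

/-- The projection of the roof to the Laurent polynomial ring. -/
def roofToLaurent : DGAHom (roofInternal h).toDGA laurentInternal.toDGA where
  f _ x := ⟨x.1.1, x.2.1⟩
  f_add _ _ _ := rfl
  f_smul _ _ _ := rfl
  f_one := rfl
  f_mul _ _ := rfl
  f_d _ := rfl

theorem exists_eq_dcast_d (S : InternalDGA) {i : ℤ} {x : S.toDGA.C i}
    (hx : ∃ v ∈ S.gr (i - 1), S.d v = x.1) :
    ∃ v : S.toDGA.C (i - 1), x = dcast S.toDGA.C (by omega) (S.toDGA.d v) := by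
  obtain ⟨v, hv, hvx⟩ := hx
  refine ⟨⟨v, hv⟩, Subtype.ext ?_⟩
  exact hvx.symm.trans (coe_dcast S.gr (by omega) (S.toDGA.d ⟨v, hv⟩)).symm

theorem isQis_roofToDGA : IsQis (roofToDGA h) := by
  refine fun i => ⟨fun y hy => ?_, fun x hx hxw => ?_⟩
  · obtain ⟨x, hx, hdx, hxy⟩ := exists_cocycle_of_cocycle (isDifferential_total A)
      (isLaurentBasis_total A h) (of_mem A y) (by rw [totalD_of, hy, map_zero])
    refine ⟨⟨x, hx⟩, 0, Subtype.ext hdx, ?_⟩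
    apply of_injective i
    rw [map_add, of_dcast, d_zero, map_zero, add_zero, ← hxy]
    exact of_apply_of_mem A hx.2.1
  · apply exists_eq_dcast_d
    obtain ⟨⟨e, a, y⟩, hmem⟩ := x
    have hdx := congrArg Subtype.val hx
    have ha : a ∈ boundaries (totalGr A) (totalD A) i := by
      have hb : of A.C i (a i) ∈ boundaries (totalGr A) (totalD A) i :=
        (of_mem_boundaries_iff A _).2 hxw
      rwa [of_apply_of_mem A (x := a) hmem.2.1] at hb
    obtain rfl := (eq_zero_iff_mem_boundaries _ _ hmem hdx).2 ha
    exact exists_fibreD_eq _ _ ha hmem.2.2 hdx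

theorem isQis_roofToLaurent : IsQis (roofToLaurent h) := by
  refine fun i => ⟨fun y hy => ?_, fun x hx hxw => ?_⟩
  · obtain ⟨x, hx, hdx, hxy⟩ := exists_cocycle_of_laurent (isDifferential_total A)
      (isLaurentBasis_total A h) y.2
    refine ⟨⟨x, hx⟩, 0, Subtype.ext hdx, Subtype.ext (hxy.trans ?_)⟩
    rw [d_zero]
    exact (add_zero _).symm.trans
      (congrArg (y.1 + ·) (coe_dcast laurentGr (by omega) (0 : laurentGr (i - 1 + 1))).symm)
  · apply exists_eq_dcast_d
    obtain ⟨⟨e, a, y⟩, hmem⟩ := x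
    have hdx := congrArg Subtype.val hx
    obtain ⟨w, hw⟩ := hxw
    obtain rfl : e = 0 := by
      refine (congrArg Subtype.val hw).trans (coe_dcast laurentGr _ _)
    exact exists_fibreD_eq _ _ ((eq_zero_iff_mem_boundaries _ _ hmem hdx).1 rfl) hmem.2.2 hdx

/-- The Laurent polynomial ring is its own cohomology. -/
def laurentCohomology : LaurentCohomology laurentInternal.toDGA where
  u k := ⟨LaurentPolynomial.T k, T_mem_laurentGr rfl⟩
  hu _ := rfl
  hone := by
    refine ⟨0, Subtype.ext ?_⟩
    refine Eq.trans ?_ (congrArg₂ (· + ·) (coe_dcast laurentGr (by omega) _).symm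
      (coe_dcast laurentGr (by omega) (0 : laurentGr (-1 + 1))).symm)
    exact (add_zero _).symm
  hmul k l := by
    refine ⟨0, Subtype.ext ((coe_dcast laurentGr (by ring) _).trans ?_)⟩
    refine Eq.trans ?_ (congrArg (_ + ·)
      (coe_dcast laurentGr (by omega) (0 : laurentGr (-2 * (k + l) - 1 + 1))).symm)
    exact (LaurentPolynomial.T_add k l).symm.trans (add_zero _).symm
  hsurj k x _ := by
    refine ⟨x.1.coeff k, 0, Subtype.ext ?_⟩
    refine Eq.trans ?_ (congrArg (_ + ·)
      (coe_dcast laurentGr (by omega) (0 : laurentGr (-2 * k - 1 + 1))).symm)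
    exact (eq_smul_T rfl x.2).trans (add_zero _).symm
  hodd i hi x _ := by
    apply exists_eq_dcast_d
    exact ⟨0, zero_mem _, (eq_zero_of_not_even hi x.2).symm⟩
  hfree k c := by
    rintro ⟨w, hw⟩
    have h0 : c • (LaurentPolynomial.T k : LaurentPolynomial ℂ) = 0 :=
      (congrArg Subtype.val hw).trans (coe_dcast laurentGr _ _)
    simpa using congrArg (fun p => p.coeff k) h0

end Total

end IntrinsicFormality

/-- The graded ring `ℂ[ι^{±1}]` of Laurent polynomials on a generator of degree `-2` is
intrinsically formal: every DG algebra `A` whose cohomology is isomorphic to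
`ℂ[ι^{±1}]` as a graded algebra is formal, i.e. `A` is quasi-isomorphic (through a
zig-zag of quasi-isomorphisms of DG algebras) to a DG algebra `E` with zero
differential whose underlying graded algebra is `ℂ[ι^{±1}]`. -/
theorem stmt_13 (A : DGA) (h : Nonempty (LaurentCohomology A)) :
    ∃ (E B : DGA) (φ : DGAHom B A) (ψ : DGAHom B E),
      (∀ (i : ℤ) (x : E.C i), E.d x = 0) ∧ Nonempty (LaurentCohomology E) ∧
      IsQis φ ∧ IsQis ψ := by
  obtain ⟨h⟩ := h
  exact ⟨IntrinsicFormality.laurentInternal.toDGA, (IntrinsicFormality.roofInternal h).toDGA,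
    IntrinsicFormality.roofToDGA h, IntrinsicFormality.roofToLaurent h, fun _ _ => rfl,
    ⟨IntrinsicFormality.laurentCohomology⟩, IntrinsicFormality.isQis_roofToDGA h,
    IntrinsicFormality.isQis_roofToLaurent h⟩
end

section
/- Let Λ be a basic finite-dimensional algebra over ℂ. Then the natural map from the outer automorphism group Out(Λ) = Aut(Λ)/Inn(Λ) to the Picard group Pic(Λ) of invertible Λ-bimodules, sending σ to the class of the twisted bimodule Λ_σ, is a group isomorphism. -/
open TensorProduct

namespace Stmt19

variable (Λ : Type) [Ring Λ] [Algebra ℂ Λ]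

/-- The tensor product over `Λ` of the twisted bimodules `Λ_σ` and `Λ_τ`: the quotient of
`Λ ⊗ℂ Λ` by the balancing relations `(a·σ(c)) ⊗ b - a ⊗ (c·b)` (the right action of the
middle `c` on `Λ_σ` being twisted by `σ`). -/
def twTensor (σ : Λ ≃ₐ[ℂ] Λ) : Type :=
  (Λ ⊗[ℂ] Λ) ⧸
    (Submodule.span ℂ
      {x : Λ ⊗[ℂ] Λ | ∃ a b c : Λ, x = (a * σ c) ⊗ₜ[ℂ] b - a ⊗ₜ[ℂ] (c * b)})

noncomputable instance (σ : Λ ≃ₐ[ℂ] Λ) : AddCommGroup (twTensor Λ σ) :=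
  Submodule.Quotient.addCommGroup _

noncomputable instance (σ : Λ ≃ₐ[ℂ] Λ) : Module ℂ (twTensor Λ σ) :=
  Submodule.Quotient.module _

/-- The class of `x : Λ ⊗ℂ Λ` in `Λ_σ ⊗_Λ Λ_τ`. -/
def twTensor.mk (σ : Λ ≃ₐ[ℂ] Λ) (x : Λ ⊗[ℂ] Λ) : twTensor Λ σ :=
  Submodule.Quotient.mk x

section Idempotents

variable {A : Type} [Ring A]

/-- A nonzero idempotent `e` such that `0` and `e` are the only idempotents of `eAe`. -/
structure IsPrimitiveIdem (e : A) : Prop where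
  idem : e * e = e
  ne_zero : e ≠ 0
  eq_zero_or_eq : ∀ k : A, k * k = k → e * k = k → k * e = k → k = 0 ∨ k = e

/-- A member of a family of orthogonal idempotents is fixed by multiplication with their sum. -/
theorem sum_mul_eq_and_mul_sum_eq {s : Finset A} (hs : ∀ f ∈ s, f * f = f)
    (hso : ∀ f ∈ s, ∀ g ∈ s, f ≠ g → f * g = 0) {f : A} (hf : f ∈ s) :
    (∑ g ∈ s, g) * f = f ∧ f * ∑ g ∈ s, g = f := by
  rw [Finset.sum_mul, Finset.mul_sum, Finset.sum_eq_single_of_mem f hf,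
    Finset.sum_eq_single_of_mem f hf]
  · exact ⟨hs f hf, hs f hf⟩
  · exact fun g hg hgf => hso f hf g hg hgf.symm
  · exact fun g hg hgf => hso g hg f hf hgf

variable [Algebra ℂ A] [FiniteDimensional ℂ A]

/-- Fitting's lemma in the corner `eAe` of a primitive idempotent. -/
theorem IsPrimitiveIdem.isNilpotent_or_exists_mul_eq {e : A} (he : IsPrimitiveIdem e) {x : A}
    (hex : e * x = x) (hxe : x * e = x) :
    IsNilpotent x ∨ ∃ z, e * z = z ∧ z * e = z ∧ x * z = e := by
  have hfit := (LinearMap.mulLeft ℂ x).eventually_isCompl_ker_pow_range_pow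
  obtain ⟨n, hn⟩ := Filter.eventually_atTop.1 hfit
  have hc := hn (n + 1) (Nat.le_succ n)
  set m := n + 1 with hm
  have hker : ∀ y, y ∈ LinearMap.ker (LinearMap.mulLeft ℂ x ^ m) ↔ x ^ m * y = 0 := by
    intro y
    rw [LinearMap.mem_ker, LinearMap.pow_mulLeft, LinearMap.mulLeft_apply]
  have hran : ∀ y, y ∈ LinearMap.range (LinearMap.mulLeft ℂ x ^ m) ↔ ∃ w, x ^ m * w = y := by
    intro y
    simp [LinearMap.mem_range, LinearMap.pow_mulLeft]
  have hex' : e * x ^ m = x ^ m := by rw [hm, pow_succ', ← mul_assoc, hex]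
  have hxe' : x ^ m * e = x ^ m := by rw [hm, pow_succ, mul_assoc, hxe]
  have hdisj : ∀ y, x ^ m * y = 0 → (∃ w, x ^ m * w = y) → y = 0 := fun y h1 h2 =>
    Submodule.disjoint_def.1 hc.disjoint y ((hker y).2 h1) ((hran y).2 h2)
  obtain ⟨k, hk, r, hr, hkr⟩ := Submodule.mem_sup.1
    (show e ∈ _ ⊔ _ from hc.sup_eq_top ▸ Submodule.mem_top)
  rw [hker] at hk
  obtain ⟨w, rfl⟩ := (hran r).1 hr
  have hke : k * e = k := by
    rw [← sub_eq_zero]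
    refine hdisj _ (by rw [mul_sub, ← mul_assoc, hk, zero_mul, sub_zero]) ⟨w - w * e, ?_⟩
    have h : k * e + x ^ m * w * e = k + x ^ m * w := by rw [← add_mul, hkr, he.idem]
    rw [mul_sub, ← mul_assoc, sub_eq_sub_iff_add_eq_add, h, add_comm]
  have hek : e * k = k := by
    have h : e * k + x ^ m * w = k + x ^ m * w := by
      rw [hkr, ← hex', mul_assoc, ← mul_add, hkr, he.idem]
    exact add_right_cancel h
  have hkk : k * k = k := by
    have h : k * k + x ^ m * w * k = k := by rw [← add_mul, hkr, hek]
    have h0 : x ^ m * w * k = 0 := by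
      refine hdisj _ ?_ ⟨w * k, by rw [mul_assoc]⟩
      rw [← sub_eq_iff_eq_add'.2 h.symm, mul_sub, ← mul_assoc, hk, zero_mul, sub_zero]
    rwa [h0, add_zero] at h
  rcases he.eq_zero_or_eq k hkk hek hke with rfl | rfl
  · right
    rw [zero_add] at hkr
    refine ⟨e * (x ^ n * w) * e, ?_, ?_, ?_⟩
    · simp only [← mul_assoc, he.idem]
    · rw [mul_assoc, he.idem]
    · rw [← mul_assoc, ← mul_assoc, hxe, ← mul_assoc, ← pow_succ', ← hm, hkr, he.idem]
  · exact Or.inl ⟨m, by rw [← hxe', hk]⟩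

/-- The corner of a primitive idempotent is local: if a finite sum is invertible in it,
then so is one of the summands. -/
theorem IsPrimitiveIdem.exists_mul_eq_of_sum {e : A} (he : IsPrimitiveIdem e) {ι : Type*}
    (s : Finset ι) (x : ι → A) (hex : ∀ i, e * x i = x i) (z : A)
    (hez : e * z = z) (hze : z * e = z) (h : (∑ i ∈ s, x i) * z = e) :
    ∃ i ∈ s, ∃ z, e * z = z ∧ z * e = z ∧ x i * z = e := by
  classical
  induction s using Finset.induction_on generalizing z with
  | empty => exact absurd (by simpa using h.symm) he.ne_zero
  | insert i s hi ih =>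
    rw [Finset.sum_insert hi, add_mul] at h
    rcases he.isNilpotent_or_exists_mul_eq (x := x i * z) (by rw [← mul_assoc, hex])
      (by rw [mul_assoc, hze]) with hnil | ⟨y, hey, hye, hy⟩
    · obtain ⟨w, hw, -⟩ := isUnit_iff_exists.1 hnil.isUnit_one_sub
      have hsum : (∑ j ∈ s, x j) * z = e * (1 - x i * z) := by
        rw [mul_sub, mul_one, ← mul_assoc, hex, ← h, add_sub_cancel_left]
      obtain ⟨j, hj, hj'⟩ := ih (z * (w * e)) (by rw [← mul_assoc, hez])
        (by rw [mul_assoc, mul_assoc, he.idem])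
        (by rw [← mul_assoc, hsum, mul_assoc, ← mul_assoc _ w, hw, one_mul, he.idem])
      exact ⟨j, Finset.mem_insert_of_mem hj, hj'⟩
    · exact ⟨i, Finset.mem_insert_self i s, z * y, by rw [← mul_assoc, hez],
        by rw [mul_assoc, hye], by rw [← mul_assoc, hy]⟩

/-- In a finite-dimensional algebra, every idempotent is a sum of orthogonal primitive
idempotents. -/
theorem exists_primitive_decomposition (e : A) (he : e * e = e) :
    ∃ s : Finset A, (∀ f ∈ s, IsPrimitiveIdem f) ∧
      (∀ f ∈ s, ∀ g ∈ s, f ≠ g → f * g = 0) ∧ ∑ f ∈ s, f = e := by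
  classical
  induction hV : LinearMap.range (LinearMap.mulLeft ℂ e) using WellFoundedLT.induction
    generalizing e with
  | ind V ih =>
  subst hV
  by_cases hprim : IsPrimitiveIdem e
  · exact ⟨{e}, by simpa using hprim, by simp +contextual, by simp⟩
  by_cases h0 : e = 0
  · exact ⟨∅, by simp, by simp, by simp [h0]⟩
  have hlt : ∀ k, k * k = k → e * k = k → k * e = k → k ≠ e →
      LinearMap.range (LinearMap.mulLeft ℂ k) < LinearMap.range (LinearMap.mulLeft ℂ e) := by
    intro k hkk hek hke hne
    refine lt_of_le_of_ne ?_ fun heq => hne ?_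
    · rintro _ ⟨y, rfl⟩
      exact ⟨k * y, by simp [← mul_assoc, hek]⟩
    · obtain ⟨y, hy⟩ : e ∈ LinearMap.range (LinearMap.mulLeft ℂ k) := by
        rw [heq]; exact ⟨1, by simp⟩
      rw [LinearMap.mulLeft_apply] at hy
      rw [← hke, ← hy, ← mul_assoc, hkk]
  obtain ⟨k, hkk, hek, hke, hk0, hkne⟩ :
      ∃ k, k * k = k ∧ e * k = k ∧ k * e = k ∧ k ≠ 0 ∧ k ≠ e := by
    by_contra! hcon
    refine hprim ⟨he, h0, fun k hkk hek hke => ?_⟩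
    by_cases hk0 : k = 0
    · exact Or.inl hk0
    · exact Or.inr (hcon k hkk hek hke hk0)
  have hll : (e - k) * (e - k) = e - k := by
    simp [mul_sub, sub_mul, he, hek, hke, hkk]
  obtain ⟨s, hs, hso, hsum⟩ := ih _ (hlt k hkk hek hke hkne) k hkk rfl
  obtain ⟨t, ht, hto, htum⟩ := ih _ (hlt (e - k) hll (by rw [mul_sub, he, hek])
    (by rw [sub_mul, he, hke]) (by simpa using hk0)) (e - k) hll rfl
  have hks : ∀ f ∈ s, k * f = f ∧ f * k = f := fun f hf =>
    hsum ▸ sum_mul_eq_and_mul_sum_eq (fun f hf => (hs f hf).idem) hso hf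
  have hkt : ∀ f ∈ t, (e - k) * f = f ∧ f * (e - k) = f := fun f hf =>
    htum ▸ sum_mul_eq_and_mul_sum_eq (fun f hf => (ht f hf).idem) hto hf
  have hst : ∀ f ∈ s, ∀ g ∈ t, f * g = 0 := fun f hf g hg => by
    rw [← (hks f hf).2, ← (hkt g hg).1, mul_assoc, ← mul_assoc k, mul_sub, hke, hkk, sub_self,
      zero_mul, mul_zero]
  have hts : ∀ f ∈ s, ∀ g ∈ t, g * f = 0 := fun f hf g hg => by
    rw [← (hks f hf).1, ← (hkt g hg).2, mul_assoc, ← mul_assoc (e - k), sub_mul, hek, hkk,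
      sub_self, zero_mul, mul_zero]
  have hdisj : Disjoint s t := Finset.disjoint_left.2 fun f hf hf' =>
    (hs f hf).ne_zero (by rw [← (hs f hf).idem, hst f hf f hf'])
  refine ⟨s ∪ t, ?_, ?_, by rw [Finset.sum_union hdisj, hsum, htum, add_sub_cancel]⟩
  · intro f hf
    rcases Finset.mem_union.1 hf with hf | hf
    exacts [hs f hf, ht f hf]
  · intro f hf g hg hfg
    rcases Finset.mem_union.1 hf with hf | hf <;> rcases Finset.mem_union.1 hg with hg | hg
    exacts [hso f hf g hg hfg, hst f hf g hg, hts g hg f hf, hto f hf g hg hfg]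

end Idempotents

section Morita

variable {A M N : Type} [Ring A] [Algebra ℂ A] [AddCommGroup M] [Module ℂ M] [AddCommGroup N]
  [Module ℂ N]

/-- The bimodules `M` and `N`, with left actions `l`, `lN` and right actions `r`, `rN`, form a
Morita context with associative balanced pairings `β` and `γ`, the second one being surjective. -/
structure IsMoritaContext (l : A →ₐ[ℂ] Module.End ℂ M) (r : Aᵐᵒᵖ →ₐ[ℂ] Module.End ℂ M)
    (lN : A →ₐ[ℂ] Module.End ℂ N) (rN : Aᵐᵒᵖ →ₐ[ℂ] Module.End ℂ N)
    (β : M →ₗ[ℂ] N →ₗ[ℂ] A) (γ : N →ₗ[ℂ] M →ₗ[ℂ] A) : Prop where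
  comm : ∀ a b m, l a (r b m) = r b (l a m)
  commN : ∀ a b n, lN a (rN b n) = rN b (lN a n)
  β_left : ∀ a m n, β (l a m) n = a * β m n
  β_right : ∀ a m n, β m (rN (MulOpposite.op a) n) = β m n * a
  β_bal : ∀ a m n, β (r (MulOpposite.op a) m) n = β m (lN a n)
  γ_left : ∀ a n m, γ (lN a n) m = a * γ n m
  γ_right : ∀ a n m, γ n (r (MulOpposite.op a) m) = γ n m * a
  γ_bal : ∀ a n m, γ (rN (MulOpposite.op a) n) m = γ n (l a m)
  assoc : ∀ m n m', l (β m n) m' = r (MulOpposite.op (γ n m')) m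
  exists_sum_γ : ∃ (k : ℕ) (ns : Fin k → N) (ms : Fin k → M), ∑ i, γ (ns i) (ms i) = 1

namespace IsMoritaContext

variable {l : A →ₐ[ℂ] Module.End ℂ M} {r : Aᵐᵒᵖ →ₐ[ℂ] Module.End ℂ M}
  {lN : A →ₐ[ℂ] Module.End ℂ N} {rN : Aᵐᵒᵖ →ₐ[ℂ] Module.End ℂ N}
  {β : M →ₗ[ℂ] N →ₗ[ℂ] A} {γ : N →ₗ[ℂ] M →ₗ[ℂ] A}

theorem β_mul_β (H : IsMoritaContext l r lN rN β γ) (m : M) (n : N) (m' : M) (n' : N) :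
    β m n * β m' n' = β (r (MulOpposite.op (γ n m')) m) n' := by
  rw [← H.assoc, H.β_left]

theorem γ_mul_γ (H : IsMoritaContext l r lN rN β γ) (n : N) (m : M) (n' : N) (m' : M) :
    γ n m * γ n' m' = γ n (l (β m n') m') := by
  rw [H.assoc, H.γ_right]

/-- For every primitive idempotent `e`, the projective module `Me` is isomorphic to `Af` for some
member `f` of a given complete set of orthogonal primitive idempotents. -/
theorem exists_matching (H : IsMoritaContext l r lN rN β γ) [FiniteDimensional ℂ A] {s : Finset A}
    (hs : ∀ f ∈ s, IsPrimitiveIdem f) (hsum : ∑ f ∈ s, f = 1) {e : A} (he : IsPrimitiveIdem e) :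
    ∃ f ∈ s, ∃ m n, l f m = m ∧ r (MulOpposite.op e) m = m ∧ rN (MulOpposite.op f) n = n ∧
      lN e n = n ∧ γ n m = e ∧ β m n = f := by
  obtain ⟨k, ns, ms, hk⟩ := H.exists_sum_γ
  have hγ : ∑ p ∈ s ×ˢ (Finset.univ : Finset (Fin k)), e * γ (ns p.2) (l p.1 (ms p.2)) = e := by
    rw [← Finset.mul_sum, Finset.sum_product_right]
    have h1 : ∀ i, ∑ f ∈ s, γ (ns i) (l f (ms i)) = γ (ns i) (ms i) := fun i => by
      rw [← map_sum, ← LinearMap.sum_apply, ← map_sum, hsum, map_one, Module.End.one_apply]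
    simp only [h1, hk, mul_one]
  obtain ⟨⟨f, i⟩, hfi, z, hez, hze, hz⟩ := he.exists_mul_eq_of_sum
    (s ×ˢ (Finset.univ : Finset (Fin k))) (fun p => e * γ (ns p.2) (l p.1 (ms p.2)))
    (fun p => by rw [← mul_assoc, he.idem]) e he.idem he.idem (by rw [hγ, he.idem])
  have hf : f ∈ s := (Finset.mem_product.1 hfi).1
  have hff := (hs f hf).idem
  have hlf : ∀ m, l f (l f m) = l f m := fun m => by
    rw [← Module.End.mul_apply, ← map_mul, hff]
  set m := r (MulOpposite.op z) (l f (ms i)) with hm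
  set n := lN e (rN (MulOpposite.op f) (ns i)) with hn
  have hlm : l f m = m := by rw [hm, H.comm, hlf]
  have hrm : r (MulOpposite.op e) m = m := by
    rw [hm, ← Module.End.mul_apply, ← map_mul, ← MulOpposite.op_mul, hze]
  have hrn : rN (MulOpposite.op f) n = n := by
    rw [hn, ← H.commN, ← Module.End.mul_apply (rN _), ← map_mul, ← MulOpposite.op_mul, hff]
  have hln : lN e n = n := by
    rw [hn, ← Module.End.mul_apply, ← map_mul, he.idem]
  have hγe : γ n m = e := by
    rw [hm, hn, H.γ_left, H.γ_right, H.γ_bal, hlf, ← mul_assoc]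
    exact hz
  refine ⟨f, hf, m, n, hlm, hrm, hrn, hln, hγe, ?_⟩
  refine ((hs f hf).eq_zero_or_eq (β m n) ?_ ?_ ?_).resolve_left fun h0 => he.ne_zero ?_
  · rw [H.β_mul_β, hγe, hrm]
  · rw [← H.β_left, hlm]
  · rw [← H.β_right, hrn]
  · rw [← he.idem]
    nth_rewrite 1 [← hγe]
    rw [← hγe, H.γ_mul_γ, h0, map_zero, LinearMap.zero_apply, map_zero]

/-- Over a basic algebra, the pairings of a Morita context attain `1` on a common pair. -/
theorem exists_pair_eq_one (H : IsMoritaContext l r lN rN β γ) [FiniteDimensional ℂ A]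
    (hbasic : ∀ e f u v : A, IsIdempotentElem e → IsIdempotentElem f →
      e * f = 0 → f * e = 0 → u = e * u * f → v = f * v * e → u * v = e → v * u = f → e = 0) :
    ∃ m n, β m n = 1 ∧ γ n m = 1 := by
  classical
  obtain ⟨s, hs, hso, hsum⟩ := exists_primitive_decomposition (1 : A) (one_mul 1)
  choose! π hπ m n hlm hrm hrn hln hγ hβ using
    fun e (he : e ∈ s) => H.exists_matching hs hsum (hs e he)
  have hinj : ∀ e ∈ s, ∀ e' ∈ s, π e = π e' → e = e' := by
    intro e he e' he' heq
    by_contra hne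
    have hkey : ∀ e ∈ s, ∀ e' ∈ s, π e = π e' → γ (n e) (m e') * γ (n e') (m e) = e := by
      intro e he e' he' heq
      rw [H.γ_mul_γ, hβ e' he', ← heq, hlm e he, hγ e he]
    have hcorner : ∀ e ∈ s, ∀ e' ∈ s, γ (n e) (m e') = e * γ (n e) (m e') * e' := by
      intro e he e' he'
      rw [← H.γ_left, hln e he, ← H.γ_right, hrm e' he']
    exact (hs e he).ne_zero (hbasic e e' _ _ (hs e he).idem (hs e' he').idem
      (hso e he e' he' hne) (hso e' he' e he (Ne.symm hne)) (hcorner e he e' he')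
      (hcorner e' he' e he) (hkey e he e' he' heq) (hkey e' he' e he heq.symm))
  refine ⟨∑ e ∈ s, m e, ∑ e ∈ s, n e, ?_, ?_⟩
  · have himg : s.image π = s := Finset.eq_of_subset_of_card_le
      (Finset.image_subset_iff.2 hπ) (Finset.card_image_of_injOn hinj).ge
    have hdiag : ∀ e ∈ s, ∑ e' ∈ s, β (m e) (n e') = π e := by
      intro e he
      rw [Finset.sum_eq_single_of_mem e he, hβ e he]
      intro e' he' hne
      rw [← hrm e he, H.β_bal, ← hln e' he', ← Module.End.mul_apply, ← map_mul,
        hso e he e' he' hne.symm, map_zero, LinearMap.zero_apply, map_zero]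
    simp only [map_sum, LinearMap.sum_apply]
    rw [Finset.sum_comm, Finset.sum_congr rfl hdiag, ← hsum]
    conv_rhs => rw [← himg]
    rw [Finset.sum_image hinj]
  · have hdiag : ∀ e ∈ s, ∑ e' ∈ s, γ (n e) (m e') = e := by
      intro e he
      rw [Finset.sum_eq_single_of_mem e he, hγ e he]
      intro e' he' hne
      rw [← hrn e he, H.γ_bal, ← hlm e' he', ← Module.End.mul_apply, ← map_mul,
        hso _ (hπ e he) _ (hπ e' he') fun h => hne (hinj e he e' he' h).symm, map_zero,
        LinearMap.zero_apply, map_zero]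
    simp only [map_sum, LinearMap.sum_apply]
    rw [Finset.sum_comm, Finset.sum_congr rfl hdiag, hsum]

/-- If the pairings of a Morita context attain `1` on a common pair, then the bimodule is
isomorphic to a twisted bimodule. -/
theorem exists_twist (H : IsMoritaContext l r lN rN β γ) {m₀ : M} {n₀ : N} (hβ : β m₀ n₀ = 1)
    (hγ : γ n₀ m₀ = 1) :
    ∃ (σ : A ≃ₐ[ℂ] A) (e : M ≃ₗ[ℂ] A),
      ∀ (a b : A) (m : M), e (l a (r (MulOpposite.op b) m)) = a * e m * σ b := by
  have hm : ∀ m, l (β m n₀) m₀ = m := fun m => by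
    rw [H.assoc, hγ, MulOpposite.op_one, map_one, Module.End.one_apply]
  let f : A →ₐ[ℂ] A := AlgHom.ofLinearMap
    (β.flip n₀ ∘ₗ LinearMap.applyₗ m₀ ∘ₗ r.toLinearMap ∘ₗ
      (MulOpposite.opLinearEquiv ℂ).toLinearMap)
    (by simp [hβ])
    (fun b c => by
      simp only [LinearMap.comp_apply, LinearEquiv.coe_coe, MulOpposite.coe_opLinearEquiv,
        AlgHom.toLinearMap_apply, LinearMap.applyₗ_apply_apply, LinearMap.flip_apply]
      rw [H.β_mul_β, H.γ_right, hγ, one_mul, ← Module.End.mul_apply, ← map_mul,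
        MulOpposite.op_mul])
  have hf : ∀ b, f b = β (r (MulOpposite.op b) m₀) n₀ := fun _ => rfl
  have hbij : Function.Bijective f := by
    refine Function.bijective_iff_has_inverse.2 ⟨fun a => γ n₀ (l a m₀), fun b => ?_, fun a => ?_⟩
    · simp only [hf]
      rw [hm, H.γ_right, hγ, one_mul]
    · simp only [hf]
      rw [← H.assoc, hβ, map_one, Module.End.one_apply, H.β_left, hβ, mul_one]
  refine ⟨AlgEquiv.ofBijective f hbij,
    LinearEquiv.ofLinearMap (β.flip n₀) (LinearMap.applyₗ m₀ ∘ₗ l.toLinearMap)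
      (LinearMap.ext fun a => by simp [H.β_left, hβ]) (LinearMap.ext fun m => by simp [hm]), ?_⟩
  intro a b m
  rw [AlgEquiv.ofBijective_apply, hf]
  simp only [LinearEquiv.coe_ofLinearMap, LinearMap.flip_apply]
  rw [H.β_left, mul_assoc, H.β_mul_β, H.γ_right, hγ, one_mul]

end IsMoritaContext

end Morita

/-- The twisted bimodules of `σ` and `τ` are isomorphic iff `σ` and `τ` differ by an inner
automorphism. -/
theorem exists_twisted_equiv_iff {A : Type} [Ring A] [Algebra ℂ A] (σ τ : A ≃ₐ[ℂ] A) :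
    (∃ e : A ≃ₗ[ℂ] A, ∀ a x b : A, e (a * x * σ b) = a * e x * τ b) ↔
      ∃ w : Aˣ, ∀ x : A, τ x = (w : A) * σ x * ((w⁻¹ : Aˣ) : A) := by
  constructor
  · rintro ⟨e, he⟩
    have he1 : ∀ x, e x = x * e 1 := fun x => by simpa using he x 1 1
    have h1 : e.symm 1 * e 1 = 1 := by rw [← he1, e.apply_symm_apply]
    have h2 : e 1 * e.symm 1 = 1 :=
      e.injective (by rw [he1, mul_assoc, h1, mul_one])
    refine ⟨⟨e.symm 1, e 1, h1, h2⟩, fun x => ?_⟩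
    have hx : σ x * e 1 = e 1 * τ x := by
      rw [← he1]
      simpa using he 1 1 x
    simp only [Units.inv_mk, mul_assoc, hx]
    rw [← mul_assoc, h1, one_mul]
  · rintro ⟨w, hw⟩
    refine ⟨LinearEquiv.ofLinearMap (LinearMap.mulRight ℂ ((w⁻¹ : Aˣ) : A))
      (LinearMap.mulRight ℂ (w : A)) (LinearMap.ext fun x => by simp)
      (LinearMap.ext fun x => by simp), fun a x b => ?_⟩
    simp [hw, mul_assoc]

/-- Multiplication identifies `Λ_σ ⊗_Λ Λ` with `Λ`. -/
theorem exists_twTensor_equiv (σ : Λ ≃ₐ[ℂ] Λ) :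
    ∃ e : twTensor Λ σ ≃ₗ[ℂ] Λ, ∀ a b : Λ, e (twTensor.mk Λ σ (a ⊗ₜ[ℂ] b)) = a * σ b := by
  let F : Λ ⊗[ℂ] Λ →ₗ[ℂ] Λ :=
    LinearMap.mul' ℂ Λ ∘ₗ TensorProduct.map LinearMap.id σ.toLinearMap
  have hF : ∀ a b, F (a ⊗ₜ b) = a * σ b := fun a b => by simp [F]
  let S : Submodule ℂ (Λ ⊗[ℂ] Λ) := Submodule.span ℂ
    {x : Λ ⊗[ℂ] Λ | ∃ a b c : Λ, x = (a * σ c) ⊗ₜ[ℂ] b - a ⊗ₜ[ℂ] (c * b)}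
  have hS : S ≤ LinearMap.ker F := by
    refine Submodule.span_le.2 ?_
    rintro _ ⟨a, b, c, rfl⟩
    simp [hF, mul_assoc]
  let G : Λ →ₗ[ℂ] (Λ ⊗[ℂ] Λ) ⧸ S := S.mkQ ∘ₗ (TensorProduct.mk ℂ Λ Λ).flip 1
  refine ⟨LinearEquiv.ofLinearMap (S.liftQ F hS) G ?_ ?_, hF⟩
  · refine LinearMap.ext fun a => ?_
    change F (a ⊗ₜ 1) = a
    rw [hF, map_one, mul_one]
  · refine Submodule.linearMap_qext _ (TensorProduct.ext' fun a b => ?_)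
    change S.mkQ (F (a ⊗ₜ b) ⊗ₜ 1) = S.mkQ (a ⊗ₜ b)
    rw [hF]
    exact (Submodule.Quotient.eq S).2 (Submodule.subset_span ⟨a, 1, b, by rw [mul_one]⟩)

/-- For a basic finite-dimensional ℂ-algebra `Λ`, the map `Out(Λ) → Pic(Λ)`,
`σ ↦ [Λ_σ]`, from the outer automorphism group to the Picard group of invertible
`Λ`-bimodules is a group isomorphism.  Concretely:

(1) (injectivity modulo inner automorphisms) `Λ_σ ≅ Λ_τ` as bimodules if and only if
`τ = (conjugation by a unit) ∘ σ`;

(2) (surjectivity) every invertible `Λ`-bimodule `M` — invertibility being encoded by a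
Morita context: an inverse bimodule `N` with balanced bimodule pairings `β : M × N → Λ`
and `γ : N × M → Λ` which are associative and surjective — is isomorphic to `Λ_σ` for
some algebra automorphism `σ`;

(3) (multiplicativity) `Λ_σ ⊗_Λ Λ_τ ≅ Λ_{σ∘τ}` as `Λ`-bimodules. -/
theorem stmt_19 [FiniteDimensional ℂ Λ]
    (hbasic : ∀ e f u v : Λ, IsIdempotentElem e → IsIdempotentElem f →
      e * f = 0 → f * e = 0 → u = e * u * f → v = f * v * e → u * v = e → v * u = f →
      e = 0) :
    -- (1)
    ((∀ σ τ : Λ ≃ₐ[ℂ] Λ,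
      (∃ e : Λ ≃ₗ[ℂ] Λ, ∀ a x b : Λ, e (a * x * σ b) = a * e x * τ b) ↔
        ∃ w : Λˣ, ∀ x : Λ, τ x = (w : Λ) * σ x * ((w⁻¹ : Λˣ) : Λ)) ∧
    -- (2)
    (∀ (M : Type) [AddCommGroup M] [Module ℂ M]
      (l : Λ →ₐ[ℂ] Module.End ℂ M) (r : Λᵐᵒᵖ →ₐ[ℂ] Module.End ℂ M),
      (∀ (a : Λ) (b : Λᵐᵒᵖ) (m : M), l a (r b m) = r b (l a m)) →
      (∃ (N : Type) (_ : AddCommGroup N) (_ : Module ℂ N)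
        (lN : Λ →ₐ[ℂ] Module.End ℂ N) (rN : Λᵐᵒᵖ →ₐ[ℂ] Module.End ℂ N)
        (β : M →ₗ[ℂ] N →ₗ[ℂ] Λ) (γ : N →ₗ[ℂ] M →ₗ[ℂ] Λ),
        (∀ (a : Λ) (b : Λᵐᵒᵖ) (n : N), lN a (rN b n) = rN b (lN a n)) ∧
        (∀ (a : Λ) (m : M) (n : N), β (l a m) n = a * β m n) ∧
        (∀ (a : Λ) (m : M) (n : N), β m (rN (MulOpposite.op a) n) = β m n * a) ∧
        (∀ (a : Λ) (m : M) (n : N), β (r (MulOpposite.op a) m) n = β m (lN a n)) ∧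
        (∀ (a : Λ) (n : N) (m : M), γ (lN a n) m = a * γ n m) ∧
        (∀ (a : Λ) (n : N) (m : M), γ n (r (MulOpposite.op a) m) = γ n m * a) ∧
        (∀ (a : Λ) (n : N) (m : M), γ (rN (MulOpposite.op a) n) m = γ n (l a m)) ∧
        (∀ (m : M) (n : N) (m' : M),
          l (β m n) m' = r (MulOpposite.op (γ n m')) m) ∧
        (∀ (n : N) (m : M) (n' : N),
          lN (γ n m) n' = rN (MulOpposite.op (β m n')) n) ∧
        (∃ (k : ℕ) (ms : Fin k → M) (ns : Fin k → N), ∑ i, β (ms i) (ns i) = 1) ∧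
        (∃ (k : ℕ) (ns : Fin k → N) (ms : Fin k → M), ∑ i, γ (ns i) (ms i) = 1)) →
      ∃ (σ : Λ ≃ₐ[ℂ] Λ) (e : M ≃ₗ[ℂ] Λ),
        ∀ (a b : Λ) (m : M), e (l a (r (MulOpposite.op b) m)) = a * e m * σ b) ∧
    -- (3)
    (∀ σ τ : Λ ≃ₐ[ℂ] Λ,
      ∃ e : twTensor Λ σ ≃ₗ[ℂ] Λ,
        (∀ a b : Λ, e (twTensor.mk Λ σ (a ⊗ₜ[ℂ] b)) = a * σ b) ∧
        (∀ a b c : Λ, e (twTensor.mk Λ σ ((c * a) ⊗ₜ[ℂ] b)) =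
          c * e (twTensor.mk Λ σ (a ⊗ₜ[ℂ] b))) ∧
        (∀ a b c : Λ, e (twTensor.mk Λ σ (a ⊗ₜ[ℂ] (b * τ c))) =
          e (twTensor.mk Λ σ (a ⊗ₜ[ℂ] b)) * (τ.trans σ) c))) := by
  refine ⟨exists_twisted_equiv_iff, ?_, fun σ τ => ?_⟩
  · rintro M _ _ l r hcomm ⟨N, _, _, lN, rN, β, γ, hN, h1, h2, h3, h4, h5, h6, h7, -, -, h8⟩
    have H : IsMoritaContext l r lN rN β γ := ⟨hcomm, hN, h1, h2, h3, h4, h5, h6, h7, h8⟩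
    obtain ⟨m₀, n₀, hβ, hγ⟩ := H.exists_pair_eq_one hbasic
    exact H.exists_twist hβ hγ
  · obtain ⟨e, he⟩ := exists_twTensor_equiv Λ σ
    refine ⟨e, he, fun a b c => ?_, fun a b c => ?_⟩
    · rw [he, he, mul_assoc]
    · rw [he, he, map_mul, mul_assoc, AlgEquiv.trans_apply]

end Stmt19
end
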